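/- arXiv:1808.04520 — 7 statements merged into one kernel-verified Lean document; each statement's English description precedes it below -/
import Mathlib

section
/- Let n be a positive integer. If GL₂(ℤ/nℤ) has a subquotient that is isomorphic to PGL₂(ℤ/5ℤ), then 5 divides n. -/
open scoped MatrixGroups

/-- `PGL₂(R)`: the quotient of `GL₂(R)` by its center. -/
abbrev PGL2 (R : Type*) [CommRing R] : Type _ :=
  GL (Fin 2) R ⧸ Subgroup.center (GL (Fin 2) R)

/-- A group `Q` is a subquotient of `Γ` if there are subgroups `N ⊴ G ≤ Γ` with `G/N ≅ Q`. -/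
def IsSubquotient (Γ : Type*) [Group Γ] (Q : Type*) [Group Q] : Prop :=
  ∃ (G : Subgroup Γ) (N : Subgroup G) (hN : N.Normal),
    haveI := hN
    Nonempty ((G ⧸ N) ≃* Q)

/-- A 2×2 matrix commuting with a non-scalar matrix `z` is a polynomial in `z`. -/
theorem Matrix.exists_eq_smul_one_add_smul_of_commute {F : Type*} [Field F]
    {z x : Matrix (Fin 2) (Fin 2) F} (hz : ∀ c : F, z ≠ c • 1) (h : z * x = x * z) :
    ∃ a b : F, x = a • 1 + b • z := by
  have h00 := congrFun (congrFun h 0) 0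
  have h01 := congrFun (congrFun h 0) 1
  have h10 := congrFun (congrFun h 1) 0
  simp only [Matrix.mul_apply, Fin.sum_univ_two] at h00 h01 h10
  have key : ∀ a b : F, x 0 0 = a + b * z 0 0 → x 0 1 = b * z 0 1 → x 1 0 = b * z 1 0 →
      x 1 1 = a + b * z 1 1 → x = a • 1 + b • z := by
    intro a b e1 e2 e3 e4
    ext i j
    fin_cases i <;> fin_cases j <;> simp [e1, e2, e3, e4]
  by_cases hb : z 0 1 = 0
  · by_cases hc : z 1 0 = 0
    · have hd : z 0 0 - z 1 1 ≠ 0 := by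
        intro hd
        apply hz (z 0 0)
        ext i j
        fin_cases i <;> fin_cases j <;> simp [hb, hc, sub_eq_zero.1 hd]
      refine ⟨_, _, key (x 0 0 - (x 0 0 - x 1 1) / (z 0 0 - z 1 1) * z 0 0)
        ((x 0 0 - x 1 1) / (z 0 0 - z 1 1)) ?_ ?_ ?_ ?_⟩
      · ring
      · rw [hb] at h01 ⊢
        apply mul_right_cancel₀ hd
        linear_combination h01
      · rw [hc] at h10 ⊢
        apply mul_right_cancel₀ hd
        linear_combination -h10
      · field_simp
        ring
    · refine ⟨_, _, key (x 0 0 - x 1 0 / z 1 0 * z 0 0) (x 1 0 / z 1 0) ?_ ?_ ?_ ?_⟩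
      · ring
      · field_simp
        linear_combination -h00
      · field_simp
      · field_simp
        linear_combination -h10
  · refine ⟨_, _, key (x 0 0 - x 0 1 / z 0 1 * z 0 0) (x 0 1 / z 0 1) ?_ ?_ ?_ ?_⟩
    · ring
    · field_simp
    · field_simp
      linear_combination h00
    · field_simp
      linear_combination h01

/-- The centralizer of a non-scalar 2×2 matrix is commutative. -/
theorem Matrix.commute_of_commute_of_ne_smul_one {F : Type*} [Field F]
    {z x y : Matrix (Fin 2) (Fin 2) F} (hz : ∀ c : F, z ≠ c • 1) (hx : z * x = x * z)
    (hy : z * y = y * z) : x * y = y * x := by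
  obtain ⟨a, b, rfl⟩ := exists_eq_smul_one_add_smul_of_commute hz hx
  simp only [add_mul, mul_add, smul_mul_assoc, mul_smul_comm, one_mul, mul_one, hy]

/-- A 2×2 matrix of finite order prime to the characteristic with a double eigenvalue is scalar. -/
theorem Matrix.eq_smul_one_of_trace_sq_eq {F : Type*} [Field F] {z : Matrix (Fin 2) (Fin 2) F}
    (h2 : (2 : F) ≠ 0) {m : ℕ} (hm : (m : F) ≠ 0) (hz : z ^ m = 1)
    (h : z.trace ^ 2 = 4 * z.det) : ∃ c : F, z = c • 1 := by
  obtain ⟨k, rfl⟩ : ∃ k, m = k + 1 := Nat.exists_eq_succ_of_ne_zero (by rintro rfl; simp at hm)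
  obtain ⟨n, c, hn, rfl⟩ : ∃ (n : Matrix (Fin 2) (Fin 2) F) (c : F), n * n = 0 ∧ z = c • 1 + n := by
    refine ⟨z - (z.trace / 2) • 1, z.trace / 2, ?_, by abel⟩
    rw [Matrix.trace_fin_two, Matrix.det_fin_two] at h
    rw [Matrix.trace_fin_two]
    ext i j
    fin_cases i <;> fin_cases j <;>
      simp [Matrix.mul_apply, Fin.sum_univ_two] <;> field_simp <;>
      first | (ring; done) | linear_combination h
  have hpow : ∀ j : ℕ, (c • (1 : Matrix (Fin 2) (Fin 2) F) + n) ^ (j + 1) =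
      c ^ (j + 1) • 1 + ((j + 1 : ℕ) * c ^ j : F) • n := by
    intro j
    induction j with
    | zero => simp
    | succ j ih =>
      rw [pow_succ, ih]
      simp only [add_mul, mul_add, smul_mul_assoc, mul_smul_comm, one_mul, mul_one, hn, smul_zero,
        add_zero]
      push_cast
      module
  rw [hpow] at hz
  have hc : c ≠ 0 := by
    rintro rfl
    have h1 : (1 : Matrix (Fin 2) (Fin 2) F) * 1 = 0 := by
      rw [← hz]
      simp [add_mul, hn]
    simp at h1
  refine ⟨c + (((k + 1 : ℕ) * c ^ k : F))⁻¹ * (1 - c ^ (k + 1)), ?_⟩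
  have he : ((k + 1 : ℕ) * c ^ k : F) ≠ 0 := mul_ne_zero hm (pow_ne_zero _ hc)
  have : n = (((k + 1 : ℕ) * c ^ k : F))⁻¹ • ((1 - c ^ (k + 1)) • 1) := by
    rw [eq_inv_smul_iff₀ he, sub_smul, one_smul]
    exact eq_sub_of_add_eq' hz
  rw [add_smul, ← smul_smul, ← this]

/-- If a conjugate `h z h⁻¹` of a non-scalar 2×2 matrix `z` of finite order prime to the
characteristic commutes with `z`, then `h ^ 2` commutes with `z`. -/
theorem Matrix.GeneralLinearGroup.sq_commute_of_conj_commute {F : Type*} [Field F]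
    {z h : GL (Fin 2) F} (h2 : (2 : F) ≠ 0) (hz : ∀ c : F, z.1 ≠ c • 1) {m : ℕ}
    (hm : (m : F) ≠ 0) (hzm : z ^ m = 1) (hc : Commute z (h * z * h⁻¹)) : Commute z (h ^ 2) := by
  obtain ⟨a, b, hab⟩ := Matrix.exists_eq_smul_one_add_smul_of_commute (x := (h * z * h⁻¹).1) hz
    (congrArg Units.val hc.eq)
  have ht : (h * z * h⁻¹).1.trace = z.1.trace := by
    rw [Units.val_mul, Matrix.trace_mul_comm, ← Units.val_mul]
    congr 2
    group
  have hd : (h * z * h⁻¹).1.det = z.1.det := by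
    rw [Units.val_mul, Matrix.det_mul, mul_comm, ← Matrix.det_mul, ← Units.val_mul]
    congr 2
    group
  have hne : z.1.trace ^ 2 - 4 * z.1.det ≠ 0 := fun h0 ↦ by
    obtain ⟨c, hc⟩ := Matrix.eq_smul_one_of_trace_sq_eq h2 hm
      (by rw [← Units.val_pow_eq_pow_val, hzm, Units.val_one]) (sub_eq_zero.1 h0)
    exact hz c hc
  rw [hab] at ht hd
  rw [Matrix.trace_fin_two, Matrix.trace_fin_two] at ht
  rw [Matrix.det_fin_two, Matrix.det_fin_two] at hd
  rw [Matrix.trace_fin_two, Matrix.det_fin_two] at hne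
  simp at ht hd
  have hb : (b - 1) * (b + 1) = 0 := by
    apply (mul_eq_zero.1 (?_ : _ * _ = (0 : F))).resolve_right hne
    linear_combination ht * (2 * a + (b + 1) * (z.1 0 0 + z.1 1 1)) - 4 * hd
  have hconj : h.1 * z.1 = (a • 1 + b • z.1) * h.1 := by
    rw [← hab, ← Units.val_mul, ← Units.val_mul]
    congr 1
    group
  have ha : a * (1 + b) = 0 := by
    rcases mul_eq_zero.1 hb with hb | hb
    · have : 2 * a = 0 := by linear_combination ht - hb * (z.1 0 0 + z.1 1 1)
      rw [(mul_eq_zero.1 this).resolve_left h2, zero_mul]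
    · rw [add_comm, hb, mul_zero]
  apply Units.ext
  calc z.1 * (h ^ 2).1 = (a * (1 + b)) • (h.1 * h.1) + z.1 * (h.1 * h.1) +
        ((b - 1) * (b + 1)) • (z.1 * (h.1 * h.1)) := by
        rw [ha, hb, zero_smul, zero_smul, zero_add, add_zero, sq, Units.val_mul]
    _ = (a • 1 + b • (a • 1 + b • z.1)) * h.1 * h.1 := by
        simp only [add_mul, smul_mul_assoc, one_mul, mul_assoc, smul_add]
        module
    _ = h.1 * ((a • 1 + b • z.1) * h.1) := by
        rw [← mul_assoc, mul_add, mul_smul_comm, mul_smul_comm, mul_one, hconj]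
        simp only [add_mul, smul_mul_assoc, one_mul]
    _ = (h ^ 2).1 * z.1 := by rw [← hconj, sq, Units.val_mul, mul_assoc]

/-- Let `φ : X → Q` map onto elements `u`, `s` with `s` normalizing `⟨u⟩` and `u` of order `p`. Then
some `p`-subgroup of `X` has an element mapping to `u` and is normalized by an element mapping into
`⟨u⟩ s`. -/
theorem exists_isPGroup_of_normalizer_zpowers {X Q : Type*} [Group X] [Finite X] [Group Q]
    {φ : X →* Q} (hφ : Function.Surjective φ) {p : ℕ} [Fact p.Prime] {u s : Q} (hu : u ^ p = 1)
    (hs : s ∈ Subgroup.normalizer (Subgroup.zpowers u : Set Q)) :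
    ∃ (P : Subgroup X) (g h : X) (k : ℤ), IsPGroup p P ∧ g ∈ P ∧ φ g = u ∧
      h ∈ Subgroup.normalizer (P : Set X) ∧ φ h = u ^ k * s := by
  set L : Subgroup X := (Subgroup.zpowers u).comap φ with hL
  obtain ⟨x, hx⟩ := hφ u
  obtain ⟨h₀, hh₀⟩ := hφ s
  obtain ⟨y, hyp, hyu⟩ : ∃ y : X, (∃ k, y ^ p ^ k = 1) ∧ φ y = u := by
    obtain ⟨k, m, hm, hkm⟩ := Nat.exists_eq_pow_mul_and_not_dvd (orderOf_pos x).ne' p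
      (Fact.out : p.Prime).ne_one
    obtain ⟨j, -, hj⟩ := Nat.exists_mul_mod_eq_one_of_coprime
      (((Fact.out : p.Prime).coprime_iff_not_dvd.2 hm).symm) (Fact.out : p.Prime).one_lt
    refine ⟨x ^ (m * j), ⟨k, ?_⟩, ?_⟩
    · rw [← pow_mul, mul_right_comm, mul_comm m, ← hkm, pow_mul, pow_orderOf_eq_one, one_pow]
    · rw [map_pow, hx, ← Nat.mod_add_div (m * j) p, hj, pow_add, pow_mul, hu, one_pow, pow_one,
        mul_one]
  have hyL : y ∈ L := by
    rw [hL, Subgroup.mem_comap, hyu]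
    exact Subgroup.mem_zpowers u
  have hyP : IsPGroup p (Subgroup.zpowers (⟨y, hyL⟩ : L)) := by
    obtain ⟨k, hk⟩ := hyp
    rintro ⟨_, n, rfl⟩
    refine ⟨k, ?_⟩
    ext
    simp only [SubgroupClass.coe_zpow, Subgroup.coe_one, Subgroup.coe_pow]
    rw [← zpow_natCast, ← zpow_mul, mul_comm, zpow_mul, zpow_natCast, hk, one_zpow]
  obtain ⟨P, hP⟩ := hyP.exists_le_sylow
  have hh₀L : h₀ ∈ Subgroup.normalizer (L : Set X) := by
    rw [Subgroup.mem_normalizer_iff] at hs ⊢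
    intro a
    have := hs (φ a)
    simpa [hL, hh₀] using this
  obtain ⟨l, hl⟩ := MulAction.exists_smul_eq L (L.normalizerMonoidHom ⟨h₀, hh₀L⟩ • P) P
  obtain ⟨k, hk⟩ := Subgroup.mem_zpowers_iff.1 (Subgroup.mem_comap.1 l.2)
  refine ⟨(P : Subgroup L).map L.subtype, y, l * h₀, k, P.2.map _,
    ⟨⟨y, hyL⟩, hP (Subgroup.mem_zpowers _), rfl⟩, hyu, ?_, by rw [map_mul, hk, hh₀]⟩
  have hmem : ∀ a ∈ (P : Subgroup L).map L.subtype,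
      (l * h₀) * a * (l * h₀)⁻¹ ∈ (P : Subgroup L).map L.subtype := by
    rintro _ ⟨a, ha, rfl⟩
    refine ⟨l * L.normalizerMonoidHom ⟨h₀, hh₀L⟩ a * l⁻¹, ?_, ?_⟩
    · have h1 : L.normalizerMonoidHom ⟨h₀, hh₀L⟩ a ∈
          (L.normalizerMonoidHom ⟨h₀, hh₀L⟩ • P : Sylow p L) :=
        Subgroup.smul_mem_pointwise_smul a _ (P : Subgroup L) ha
      have h2 := Subgroup.smul_mem_pointwise_smul _ (MulAut.conj l)
        ((L.normalizerMonoidHom ⟨h₀, hh₀L⟩ • P : Sylow p L) : Subgroup L) h1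
      have h3 : l * L.normalizerMonoidHom ⟨h₀, hh₀L⟩ a * l⁻¹ ∈
        (l • (L.normalizerMonoidHom ⟨h₀, hh₀L⟩ • P) : Sylow p L) := h2
      rwa [hl] at h3
    · show (l : X) * (h₀ * a * h₀⁻¹) * (l : X)⁻¹ = _
      simp only [Subgroup.subtype_apply]
      group
  exact Subgroup.mem_normalizer_fintype hmem

/-- In a finite non-commutative `p`-group, some non-central element has all its commutators
central. -/
theorem IsPGroup.exists_notMem_center_commutator_mem_center {P : Type*} [Group P] [Finite P] {p : ℕ}
    [Fact p.Prime] (hP : IsPGroup p P) (hne : Subgroup.center P ≠ ⊤) :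
    ∃ x ∉ Subgroup.center P, ∀ y : P, y * x * y⁻¹ * x⁻¹ ∈ Subgroup.center P := by
  have : Nontrivial (P ⧸ Subgroup.center P) := by
    rwa [QuotientGroup.nontrivial_iff]
  have := (hP.to_quotient (Subgroup.center P)).center_nontrivial
  obtain ⟨⟨q, hq⟩, hq1⟩ := exists_ne (1 : Subgroup.center (P ⧸ Subgroup.center P))
  induction q using QuotientGroup.induction_on with | H x => ?_
  refine ⟨x, fun hx ↦ hq1 (Subtype.ext ((QuotientGroup.eq_one_iff x).2 hx)), fun y ↦ ?_⟩
  rw [← QuotientGroup.eq_one_iff]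
  have := Subgroup.mem_center_iff.1 hq y
  simp only [QuotientGroup.mk_mul, QuotientGroup.mk_inv, this]
  group

/-- If an element `h` normalizes a finite `p`-subgroup of `GL₂(F)`, where `p` is an odd prime
different from the characteristic of `F`, which is also odd, then `h ^ 2` centralizes it. -/
theorem Matrix.GeneralLinearGroup.sq_commute_of_mem_normalizer {F : Type*} [Field F]
    {p : ℕ} [Fact p.Prime] (hp2 : p ≠ 2) (hpF : (p : F) ≠ 0) (h2 : (2 : F) ≠ 0)
    {P : Subgroup (GL (Fin 2) F)} [Finite P] (hP : IsPGroup p P) {h : GL (Fin 2) F}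
    (hh : h ∈ Subgroup.normalizer (P : Set (GL (Fin 2) F))) {g : GL (Fin 2) F} (hg : g ∈ P) :
    Commute g (h ^ 2) := by
  by_cases hZ : ∀ z ∈ Subgroup.center P, ∃ c : F, z.1.1 = c • 1
  · have htop : Subgroup.center P = ⊤ := by
      by_contra hne
      obtain ⟨x, hx, hxy⟩ := hP.exists_notMem_center_commutator_mem_center hne
      refine hx (Subgroup.mem_center_iff.2 fun y ↦ ?_)
      obtain ⟨c, hc⟩ := hZ _ (hxy y)
      set z := y * x * y⁻¹ * x⁻¹ with hz
      have hdet : z.1.1.det = 1 := by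
        have : Matrix.GeneralLinearGroup.det z.1 = 1 := by
          simp [hz, mul_comm, mul_assoc]
        simpa using congrArg Units.val this
      have hc2 : c * c = 1 := by
        simpa only [hc, Matrix.det_smul, Matrix.det_one, Fintype.card_fin, sq, mul_one] using hdet
      have hz2 : z ^ 2 = 1 := by
        ext1
        apply Units.ext
        simp [sq, hc, smul_smul, hc2]
      obtain ⟨k, hk⟩ := hP z
      have hz1 : z = 1 := by
        have := orderOf_dvd_of_pow_eq_one hz2
        have h3 := orderOf_dvd_of_pow_eq_one hk
        have h4 : Nat.Coprime 2 (p ^ k) :=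
          Nat.Coprime.pow_right k ((Nat.coprime_primes Nat.prime_two Fact.out).2 hp2.symm)
        exact orderOf_eq_one_iff.1 (Nat.eq_one_of_dvd_coprimes h4 this h3)
      rw [hz, mul_inv_eq_one, mul_inv_eq_iff_eq_mul] at hz1
      exact hz1
    obtain ⟨c, hc⟩ := hZ ⟨g, hg⟩ (htop ▸ Subgroup.mem_top _)
    apply Units.ext
    rw [Units.val_mul, Units.val_mul]
    simp only at hc
    simp [hc]
  · push Not at hZ
    obtain ⟨z, hz, hzc⟩ := hZ
    obtain ⟨k, hk⟩ := hP z
    have hcomm : ∀ y ∈ P, Commute z.1 y := fun y hy ↦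
      (congrArg Subtype.val (Subgroup.mem_center_iff.1 hz ⟨y, hy⟩)).symm
    have h1 : Commute z.1 (h ^ 2) :=
      sq_commute_of_conj_commute h2 hzc (m := p ^ k) (by push_cast; exact pow_ne_zero _ hpF)
        (by simpa using congrArg Subtype.val hk)
        (hcomm _ ((Subgroup.mem_normalizer_iff.1 hh _).1 z.2))
    exact Units.ext (Matrix.commute_of_commute_of_ne_smul_one hzc
      (congrArg Units.val (hcomm g hg).eq) (congrArg Units.val h1.eq))

/-- If `f` and `g` are ring homomorphisms whose kernels have product zero, then the kernels of the
induced maps on `GL n` commute. -/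
theorem Matrix.GeneralLinearGroup.commute_of_map_eq_one {n R S T : Type*} [Fintype n]
    [DecidableEq n] [CommRing R] [CommRing S] [CommRing T] {f : R →+* S} {g : R →+* T}
    (hfg : ∀ r s, f r = 0 → g s = 0 → r * s = 0) {x y : GL n R} (hx : map f x = 1)
    (hy : map g y = 1) : Commute x y := by
  have hx' : ∀ i j, f ((x.1 - 1) i j) = 0 := fun i j ↦ by
    have : f (x.1 i j) = (1 : Matrix n n S) i j := congrArg (fun z : GL n S ↦ z.1 i j) hx
    rw [Matrix.sub_apply, map_sub, this, Matrix.one_apply, Matrix.one_apply]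
    split_ifs <;> simp
  have hy' : ∀ i j, g ((y.1 - 1) i j) = 0 := fun i j ↦ by
    have : g (y.1 i j) = (1 : Matrix n n T) i j := congrArg (fun z : GL n T ↦ z.1 i j) hy
    rw [Matrix.sub_apply, map_sub, this, Matrix.one_apply, Matrix.one_apply]
    split_ifs <;> simp
  have h1 : (x.1 - 1) * (y.1 - 1) = 0 := by
    ext i j
    exact Finset.sum_eq_zero fun k _ ↦ hfg _ _ (hx' _ _) (hy' _ _)
  have h2 : (y.1 - 1) * (x.1 - 1) = 0 := by
    ext i j
    exact Finset.sum_eq_zero fun k _ ↦ by rw [mul_comm]; exact hfg _ _ (hx' _ _) (hy' _ _)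
  apply Units.ext
  rw [Units.val_mul, Units.val_mul]
  calc x.1 * y.1 = (x.1 - 1) * (y.1 - 1) + (x.1 + y.1 - 1) := by noncomm_ring
    _ = (y.1 - 1) * (x.1 - 1) + (x.1 + y.1 - 1) := by rw [h1, h2]
    _ = y.1 * x.1 := by noncomm_ring

theorem ZMod.mul_eq_zero_of_castHom_eq_zero {a b : ℕ} (r s : ZMod (a * b))
    (hr : ZMod.castHom (dvd_mul_right a b) (ZMod a) r = 0)
    (hs : ZMod.castHom (dvd_mul_left b a) (ZMod b) s = 0) : r * s = 0 := by
  obtain ⟨i, rfl⟩ := ZMod.intCast_surjective r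
  obtain ⟨j, rfl⟩ := ZMod.intCast_surjective s
  rw [map_intCast, ZMod.intCast_zmod_eq_zero_iff_dvd] at hr hs
  rw [← Int.cast_mul, ZMod.intCast_zmod_eq_zero_iff_dvd, Nat.cast_mul]
  exact mul_dvd_mul hr hs

section Subquotient

variable {X Q : Type*} [Group X] [Finite X] [Group Q] {φ : X →* Q} {u s : Q}

/-- A group containing a subgroup `C₅ ⋊ C₄` with faithful action is not a subquotient of
`GL₂(ℤ/pℤ)` for a prime `p ≠ 5`. -/
theorem false_of_ker_le_of_prime {p : ℕ} (hp : p.Prime) (hp5 : p ≠ 5)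
    {α : X →* GL (Fin 2) (ZMod p)} (hφ : Function.Surjective φ) (hα : α.ker ≤ φ.ker)
    (hu1 : u ≠ 1) (hu : u ^ 5 = 1) (hs : s * u * s⁻¹ = u ^ 2) : False := by
  have : Fact p.Prime := ⟨hp⟩
  have : Fact (Nat.Prime 5) := ⟨by norm_num⟩
  have key : ∀ k, u ^ k = 1 → ¬ k.Coprime 5 := fun k hk hk5 ↦ by
    have := pow_gcd_eq_one.2 ⟨hk, hu⟩
    rw [hk5, pow_one] at this
    exact hu1 this
  rcases eq_or_ne p 2 with rfl | hp2
  · obtain ⟨x, hx⟩ := hφ u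
    have hcard : Nat.card (GL (Fin 2) (ZMod 2)) = 6 := by
      rw [Matrix.card_GL_field]
      simp [Fin.prod_univ_two]
    have hx6 : x ^ 6 ∈ φ.ker := hα <| by
      rw [MonoidHom.mem_ker, map_pow, ← hcard, pow_card_eq_one']
    rw [MonoidHom.mem_ker, map_pow, hx] at hx6
    exact key 6 hx6 (by norm_num)
  have hsn : s ∈ Subgroup.normalizer (Subgroup.zpowers u : Set Q) := by
    have : Finite (Subgroup.zpowers u) :=
      finite_zpowers.2 (isOfFinOrder_iff_pow_eq_one.2 ⟨5, by norm_num, hu⟩)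
    apply Subgroup.mem_normalizer_fintype
    rintro _ ⟨k, rfl⟩
    refine ⟨2 * k, ?_⟩
    simp only
    rw [← conj_zpow, hs, zpow_mul]
    norm_cast
  obtain ⟨P, g, h, k, hP, hg, hgu, hh, hhs⟩ := exists_isPGroup_of_normalizer_zpowers hφ hu hsn
  have hcomm : Commute (α g) (α h ^ 2) := by
    apply Matrix.GeneralLinearGroup.sq_commute_of_mem_normalizer (p := 5) (by norm_num)
      (P := P.map α) _ _ (hP.map α) _ (Subgroup.mem_map_of_mem α hg)
    · rw [Ne, ZMod.natCast_eq_zero_iff, Nat.prime_dvd_prime_iff_eq hp (by norm_num)]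
      exact hp5
    · have : ((2 : ℕ) : ZMod p) ≠ 0 := by
        rw [Ne, ZMod.natCast_eq_zero_iff, Nat.prime_dvd_prime_iff_eq hp (by norm_num)]
        exact hp2
      exact_mod_cast this
    · exact Subgroup.le_normalizer_map α (Subgroup.mem_map_of_mem α hh)
  have hmem : h ^ 2 * g * (h ^ 2)⁻¹ * g⁻¹ ∈ φ.ker := hα <| by
    simp only [MonoidHom.mem_ker, map_mul, map_pow, map_inv]
    rw [← hcomm.eq]
    group
  have hconj : ∀ n : ℕ, φ h * u ^ n * (φ h)⁻¹ = u ^ (2 * n) := fun n ↦ by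
    rw [← conj_pow, hhs, mul_inv_rev, show u ^ k * s * u * (s⁻¹ * (u ^ k)⁻¹) =
      u ^ k * (s * u * s⁻¹) * (u ^ k)⁻¹ by group, hs, pow_mul]
    group
  simp only [MonoidHom.mem_ker, map_mul, map_pow, map_inv, hgu] at hmem
  have h4 : u ^ 3 * u = u := calc
    u ^ 3 * u = φ h * (φ h * u ^ 1 * (φ h)⁻¹) * (φ h)⁻¹ := by
        rw [hconj 1, hconj 2, ← pow_succ]
    _ = φ h ^ 2 * u * (φ h ^ 2)⁻¹ := by rw [pow_one, sq]; group
    _ = u := mul_inv_eq_one.1 hmem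
  exact key 3 (mul_eq_right.1 h4) (by norm_num)

/-- A group containing a subgroup `C₅ ⋊ C₄` with faithful action, and in which nontrivial normal
subgroups do not commute, is not a subquotient of `GL₂(ℤ/nℤ)` for `n` prime to `5`. -/
theorem false_of_ker_le {n : ℕ} (hn : ¬ 5 ∣ n)
    (α : X →* GL (Fin 2) (ZMod n)) (hφ : Function.Surjective φ) (hα : α.ker ≤ φ.ker)
    (hu1 : u ≠ 1) (hu : u ^ 5 = 1) (hs : s * u * s⁻¹ = u ^ 2)
    (hQ : ∀ A B : Subgroup Q, A.Normal → B.Normal → (∀ a ∈ A, ∀ b ∈ B, Commute a b) →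
      A = ⊥ ∨ B = ⊥) : False := by
  induction n using Nat.recOnMul with
  | zero => exact hn (dvd_zero 5)
  | one =>
    obtain ⟨x, rfl⟩ := hφ u
    exact hu1 (hα (Units.ext (Subsingleton.elim _ _)))
  | prime p hp => exact false_of_ker_le_of_prime hp (by rintro rfl; exact hn dvd_rfl) hφ hα hu1 hu hs
  | mul a b iha ihb =>
    set f := ZMod.castHom (dvd_mul_right a b) (ZMod a)
    set g := ZMod.castHom (dvd_mul_left b a) (ZMod b)
    have hcomm : ∀ x ∈ (((Matrix.GeneralLinearGroup.map f).comp α).ker).map φ,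
        ∀ y ∈ (((Matrix.GeneralLinearGroup.map g).comp α).ker).map φ, Commute x y := by
      rintro _ ⟨x, hx, rfl⟩ _ ⟨y, hy, rfl⟩
      have h1 := Matrix.GeneralLinearGroup.commute_of_map_eq_one
        ZMod.mul_eq_zero_of_castHom_eq_zero hx hy
      have h2 : x * y * (y * x)⁻¹ ∈ φ.ker := hα <| by
        rw [MonoidHom.mem_ker, map_mul, map_mul, map_inv, map_mul, h1.eq, mul_inv_cancel]
      rw [MonoidHom.mem_ker, map_mul, map_inv, mul_inv_eq_one, map_mul, map_mul] at h2
      exact h2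
    rcases hQ _ _ (Subgroup.Normal.map inferInstance φ hφ)
      (Subgroup.Normal.map inferInstance φ hφ) hcomm with h | h
    · exact iha (fun h5 ↦ hn (h5.mul_right b)) _ ((Subgroup.map_eq_bot_iff _).1 h)
    · exact ihb (fun h5 ↦ hn (h5.mul_left a)) _ ((Subgroup.map_eq_bot_iff _).1 h)

end Subquotient

/-- A non-scalar 2×2 matrix is conjugate to a companion matrix. -/
theorem Matrix.exists_mul_eq_mul_companion {F : Type*} [Field F] {z : Matrix (Fin 2) (Fin 2) F}
    (hz : ∀ c : F, z ≠ c • 1) :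
    ∃ P : GL (Fin 2) F, z * P.1 = P.1 * !![0, -z.det; 1, z.trace] := by
  suffices ∃ P : Matrix (Fin 2) (Fin 2) F, P.det ≠ 0 ∧ z * P = P * !![0, -z.det; 1, z.trace] by
    obtain ⟨P, hP, h⟩ := this
    exact ⟨Matrix.GeneralLinearGroup.mkOfDetNeZero P hP, h⟩
  have key : ∀ x y : F, z * !![x, z 0 0 * x + z 0 1 * y; y, z 1 0 * x + z 1 1 * y] =
      !![x, z 0 0 * x + z 0 1 * y; y, z 1 0 * x + z 1 1 * y] * !![0, -z.det; 1, z.trace] := by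
    intro x y
    rw [Matrix.det_fin_two, Matrix.trace_fin_two]
    ext i j
    fin_cases i <;> fin_cases j <;> simp [Matrix.mul_apply, Fin.sum_univ_two] <;> ring
  by_contra! hcon
  have hdet : ∀ x y : F, x * (z 1 0 * x + z 1 1 * y) - (z 0 0 * x + z 0 1 * y) * y = 0 := by
    intro x y
    by_contra hne
    exact hcon _ (by rwa [Matrix.det_fin_two_of]) (key x y)
  have h1 := hdet 1 0
  have h2 := hdet 0 1
  have h3 := hdet 1 1
  simp at h1 h2
  simp [h1, h2] at h3
  refine hz (z 0 0) ?_
  ext i j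
  fin_cases i <;> fin_cases j <;> simp [h1, h2]
  exact sub_eq_zero.1 h3

theorem PGL2.exists_mul_eq_smul_mul {F : Type*} [Field F] {x y : GL (Fin 2) F}
    (h : Commute (x : PGL2 F) (y : PGL2 F)) : ∃ c : F, x.1 * y.1 = c • (y.1 * x.1) := by
  have h1 : ((y * x : GL (Fin 2) F) : PGL2 F) = ((x * y : GL (Fin 2) F) : PGL2 F) := h.eq.symm
  rw [QuotientGroup.eq, Matrix.GeneralLinearGroup.mem_center_iff_val_mem_range_scalar] at h1
  obtain ⟨c, hc⟩ := h1
  refine ⟨c, ?_⟩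
  have : x * y = (y * x) * ((y * x)⁻¹ * (x * y)) := by group
  rw [← Units.val_mul, this, Units.val_mul, ← hc, ← Units.val_mul]
  simp [Matrix.smul_eq_mul_diagonal]

theorem PGL2.coe_eq_one_of_val_eq_smul_one {F : Type*} [Field F] {x : GL (Fin 2) F} {c : F}
    (h : x.1 = c • 1) : (x : PGL2 F) = 1 := by
  rw [QuotientGroup.eq_one_iff, Matrix.GeneralLinearGroup.mem_center_iff_val_mem_range_scalar]
  exact ⟨c, by rw [h, Matrix.smul_one_eq_diagonal]; rfl⟩

/-- A nontrivial normal subgroup of `PGL₂(F)` contains the class of a companion matrix. -/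
theorem PGL2.exists_companion_mem {F : Type*} [Field F] {A : Subgroup (PGL2 F)} (hA : A.Normal)
    (hne : A ≠ ⊥) : ∃ (x : GL (Fin 2) F) (d t : F), (x : PGL2 F) ∈ A ∧ x.1 = !![0, -d; 1, t] := by
  obtain ⟨⟨q, hq⟩, hq1⟩ := Subgroup.ne_bot_iff_exists_ne_one.1 hne
  induction q using QuotientGroup.induction_on with | H z => ?_
  obtain ⟨P, hP⟩ := Matrix.exists_mul_eq_mul_companion (z := z.1)
    fun c hc ↦ hq1 (Subtype.ext (coe_eq_one_of_val_eq_smul_one hc))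
  refine ⟨P⁻¹ * z * P, z.1.det, z.1.trace, ?_, ?_⟩
  · have := hA.conj_mem _ hq (P : PGL2 F)⁻¹
    rwa [inv_inv] at this
  · rw [mul_assoc, Units.val_mul, Units.val_mul, hP, Units.inv_mul_cancel_left]

theorem PGL2.eq_bot_or_eq_bot_of_commute (A B : Subgroup (PGL2 (ZMod 5))) (hA : A.Normal)
    (hB : B.Normal) (hAB : ∀ a ∈ A, ∀ b ∈ B, Commute a b) : A = ⊥ ∨ B = ⊥ := by
  have hdec : ∀ d t e f : ZMod 5,
      ¬ ∀ k, ∃ c, t - k = c * (k + f) ∧ k * k + d - k * t = c * e := by decide +kernel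
  have : Fact (Nat.Prime 5) := ⟨by norm_num⟩
  by_contra! hne
  obtain ⟨x, d, t, hxA, hx⟩ := PGL2.exists_companion_mem hA hne.1
  obtain ⟨y, e, f, hyB, hy⟩ := PGL2.exists_companion_mem hB hne.2
  have key : ∀ k : ZMod 5, ∃ c : ZMod 5, t - k = c * (k + f) ∧ k * k + d - k * t = c * e := by
    intro k
    let g : GL (Fin 2) (ZMod 5) := ⟨!![1, k; 0, 1], !![1, -k; 0, 1],
      by simp [Matrix.one_fin_two], by simp [Matrix.one_fin_two]⟩
    obtain ⟨c, hc⟩ := PGL2.exists_mul_eq_smul_mul (x := g * x * g⁻¹) (y := y)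
      (hAB _ (hA.conj_mem _ hxA (g : PGL2 (ZMod 5))) _ hyB)
    have hg : (g * x * g⁻¹).1 = !![k, k * t - k * k - d; 1, t - k] := by
      rw [Units.val_mul, Units.val_mul, hx]
      show !![1, k; 0, 1] * !![0, -d; 1, t] * !![1, -k; 0, 1] = _
      ext i j
      fin_cases i <;> fin_cases j <;> simp [Matrix.mul_apply, Fin.sum_univ_two] <;> ring
    rw [hg, hy] at hc
    have h00 := congrFun (congrFun hc 0) 0
    have h10 := congrFun (congrFun hc 1) 0
    simp [Matrix.mul_apply, Fin.sum_univ_two] at h00 h10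
    exact ⟨c, by linear_combination h10, by linear_combination -h00⟩
  exact hdec d t e f key

/-- If `GL₂(ℤ/nℤ)` has a subquotient isomorphic to `PGL₂(ℤ/5ℤ)`,
then `5 ∣ n`. -/
theorem dvd_of_pgl2_five_subquotient (n : ℕ) (hn : 0 < n)
    (h : IsSubquotient (GL (Fin 2) (ZMod n)) (PGL2 (ZMod 5))) : 5 ∣ n := by
  by_contra h5
  have : NeZero n := ⟨hn.ne'⟩
  obtain ⟨G, N, hN, ⟨e⟩⟩ := h
  let u : GL (Fin 2) (ZMod 5) := ⟨!![1, 1; 0, 1], !![1, -1; 0, 1], by decide, by decide⟩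
  let s : GL (Fin 2) (ZMod 5) := ⟨!![2, 0; 0, 1], !![3, 0; 0, 1], by decide, by decide⟩
  have hu1 : (u : PGL2 (ZMod 5)) ≠ 1 := by
    intro hu
    rw [QuotientGroup.eq_one_iff, Matrix.GeneralLinearGroup.mem_center_iff_val_mem_range_scalar]
      at hu
    obtain ⟨c, hc⟩ := hu
    have h01 : (0 : ZMod 5) = 1 := congrFun (congrFun hc 0) 1
    exact absurd h01 (by decide)
  have hu : u ^ 5 = 1 := Units.ext (by decide)
  have hs : s * u * s⁻¹ = u ^ 2 := Units.ext (by decide)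
  refine false_of_ker_le (X := G) (Q := PGL2 (ZMod 5)) (u := (u : PGL2 (ZMod 5)))
    (s := (s : PGL2 (ZMod 5))) (φ := e.toMonoidHom.comp (QuotientGroup.mk' N)) h5 G.subtype
    (e.surjective.comp (QuotientGroup.mk'_surjective N)) ?_ hu1 ?_ ?_
    PGL2.eq_bot_or_eq_bot_of_commute
  · rw [Subgroup.ker_subtype]
    exact bot_le
  · exact congrArg (QuotientGroup.mk (s := Subgroup.center _)) hu
  · exact congrArg (QuotientGroup.mk (s := Subgroup.center _)) hs
end

section
/- Let n be a positive integer and let π : GL₂(ℤ/nℤ) → ∏_{p ∣ n, p prime} PGL₂(ℤ/pℤ) be the natural homomorphism obtained by reducing modulo each prime p dividing n and passing to the quotient by the center. Then the kernel of π is a solvable group. -/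
open scoped MatrixGroups

/-- The natural homomorphism `GL₂(ℤ/nℤ) → ∏_{p ∣ n, p prime} PGL₂(ℤ/pℤ)` obtained by
reducing modulo each prime `p` dividing `n` and passing to the quotient by the center. -/
def glToPGLProd (n : ℕ) :
    GL (Fin 2) (ZMod n) →* ∀ p : n.primeFactors, PGL2 (ZMod (p : ℕ)) :=
  Pi.monoidHom fun p =>
    (QuotientGroup.mk' (Subgroup.center (GL (Fin 2) (ZMod (p : ℕ))))).comp
      (Matrix.GeneralLinearGroup.map
        (ZMod.castHom (Nat.dvd_of_mem_primeFactors p.2) (ZMod (p : ℕ))))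

/-- A subgroup whose commutator subgroup lies in a solvable subgroup is solvable. -/
theorem Subgroup.isSolvable_of_commutator_le {G : Type*} [Group G] {H K : Subgroup G}
    [Group.IsSolvable K] (h : ⁅H, H⁆ ≤ K) : Group.IsSolvable H := by
  have hle : (_root_.commutator H).map H.subtype ≤ K := by rwa [H.map_subtype_commutator]
  have hK (x : _root_.commutator H) : (x : H).1 ∈ K :=
    hle (Subgroup.mem_map_of_mem H.subtype x.2)
  let f : _root_.commutator H →* K := (H.subtype.comp (_root_.commutator H).subtype).codRestrict K hK
  have hf : Function.Injective f := fun x y hxy =>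
    Subtype.ext (Subtype.ext (congrArg (fun z : K => (z : G)) hxy))
  refine (Group.isSolvable_iff_subgroup_quotient (_root_.commutator H)).2
    ⟨Group.isSolvable_of_isSolvable_injective hf, ?_⟩
  exact inferInstanceAs (Group.IsSolvable (Abelianization H))

namespace Matrix.GeneralLinearGroup

variable {m R : Type*} [Fintype m] [DecidableEq m] [CommRing R]

/-- The principal congruence subgroup of `GL m R` of level `I`. -/
def congruenceSubgroup (m : Type*) [Fintype m] [DecidableEq m] (I : Ideal R) :
    Subgroup (GL m R) :=
  (map (n := m) (Ideal.Quotient.mk I)).ker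

theorem mem_congruenceSubgroup {I : Ideal R} {g : GL m R} :
    g ∈ congruenceSubgroup m I ↔ ∀ i j, (g.1 - 1) i j ∈ I := by
  rw [congruenceSubgroup, MonoidHom.mem_ker, ← map_one (map (n := m) (Ideal.Quotient.mk I)),
    GeneralLinearGroup.ext_iff]
  refine forall₂_congr fun i j => ?_
  rw [GeneralLinearGroup.map_apply, GeneralLinearGroup.map_apply,
    Ideal.Quotient.mk_eq_mk_iff_sub_mem]
  rfl

theorem commutator_congruenceSubgroup_le (I : Ideal R) :
    ⁅congruenceSubgroup m I, congruenceSubgroup m I⁆ ≤ congruenceSubgroup m (I * I) := by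
  refine Subgroup.commutator_le.2 fun g hg h hh => ?_
  rw [mem_congruenceSubgroup] at hg hh
  rw [congruenceSubgroup, MonoidHom.mem_ker, map_commutatorElement,
    commutatorElement_eq_one_iff_mul_comm, ← map_mul, ← map_mul, GeneralLinearGroup.ext_iff]
  intro i j
  rw [GeneralLinearGroup.map_apply, GeneralLinearGroup.map_apply,
    Ideal.Quotient.mk_eq_mk_iff_sub_mem]
  have key : g.1 * h.1 - h.1 * g.1 = (g.1 - 1) * (h.1 - 1) - (h.1 - 1) * (g.1 - 1) := by
    noncomm_ring
  have hmul {A B : Matrix m m R} (hA : ∀ i j, A i j ∈ I) (hB : ∀ i j, B i j ∈ I) :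
      (A * B) i j ∈ I * I :=
    Ideal.sum_mem _ fun k _ => Ideal.mul_mem_mul (hA i k) (hB k j)
  change (g.1 * h.1 - h.1 * g.1) i j ∈ I * I
  rw [key]
  exact Ideal.sub_mem _ (hmul hg hh) (hmul hh hg)

theorem isSolvable_congruenceSubgroup {I : Ideal R} (hI : IsNilpotent I) :
    Group.IsSolvable (congruenceSubgroup m I) := by
  obtain ⟨N, hN⟩ := hI
  replace hN : I ^ 2 ^ N = ⊥ :=
    pow_eq_zero_of_le Nat.lt_two_pow_self.le hN
  induction N generalizing I with
  | zero =>
    obtain rfl : I = ⊥ := by simpa using hN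
    have hbot : congruenceSubgroup m (⊥ : Ideal R) = ⊥ :=
      (Subgroup.eq_bot_iff_forall _).2 fun g hg => Units.ext <| sub_eq_zero.1 <|
        Matrix.ext (mem_congruenceSubgroup.1 hg)
    rw [hbot]
    infer_instance
  | succ N ih =>
    have := ih (I := I * I) (by rwa [← pow_two, ← pow_mul, ← pow_succ'])
    exact Subgroup.isSolvable_of_commutator_le (commutator_congruenceSubgroup_le I)

end Matrix.GeneralLinearGroup

theorem ZMod.isNilpotent_of_forall_castHom_eq_zero {n : ℕ} (hn : n ≠ 0) {x : ZMod n}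
    (hx : ∀ p : n.primeFactors,
      ZMod.castHom (Nat.dvd_of_mem_primeFactors p.2) (ZMod (p : ℕ)) x = 0) :
    IsNilpotent x := by
  obtain ⟨a, rfl⟩ := (haveI : NeZero n := ⟨hn⟩; ZMod.natCast_zmod_surjective x)
  have hdvd : ∏ p ∈ n.primeFactors, p ∣ a :=
    Finset.prod_primes_dvd a (fun p hp => (Nat.prime_of_mem_primeFactors hp).prime)
      fun p hp => (ZMod.natCast_eq_zero_iff a p).1 (by simpa using hx ⟨p, hp⟩)
  rw [← Nat.radical_eq_prod_primeFactors,
    ← UniqueFactorizationMonoid.exists_dvd_pow_iff_radical_dvd hn] at hdvd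
  obtain ⟨k, hk⟩ := hdvd
  exact ⟨k, by rw [← Nat.cast_pow, ZMod.natCast_eq_zero_iff]; exact hk⟩

open Matrix.GeneralLinearGroup in
open scoped commutatorElement in
theorem commutator_ker_glToPGLProd_le {n : ℕ} (hn : n ≠ 0) :
    ⁅(glToPGLProd n).ker, (glToPGLProd n).ker⁆ ≤
      congruenceSubgroup (Fin 2) (nilradical (ZMod n)) := by
  refine Subgroup.commutator_le.2 fun g hg h _ => mem_congruenceSubgroup.2 fun i j =>
    mem_nilradical.2 (ZMod.isNilpotent_of_forall_castHom_eq_zero hn fun p => ?_)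
  let f := ZMod.castHom (Nat.dvd_of_mem_primeFactors p.2) (ZMod (p : ℕ))
  have hcentral : map (n := Fin 2) f g ∈ Subgroup.center (GL (Fin 2) (ZMod (p : ℕ))) :=
    (QuotientGroup.eq_one_iff _).1 (congrFun hg p)
  have hcomm : map (n := Fin 2) f ⁅g, h⁆ = map f 1 := by
    rw [map_commutatorElement, map_one, commutatorElement_eq_one_iff_mul_comm]
    exact (Subgroup.mem_center_iff.1 hcentral _).symm
  have hij := (Matrix.GeneralLinearGroup.ext_iff _ _).1 hcomm i j
  rw [Matrix.GeneralLinearGroup.map_apply, Matrix.GeneralLinearGroup.map_apply] at hij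
  change f ((⁅g, h⁆ : GL (Fin 2) (ZMod n)) i j - (1 : GL (Fin 2) (ZMod n)) i j) = 0
  rw [map_sub, hij, sub_self]

/-- The kernel of the natural homomorphism
`π : GL₂(ℤ/nℤ) → ∏_{p ∣ n, p prime} PGL₂(ℤ/pℤ)` is a solvable group. -/
theorem isSolvable_ker_glToPGLProd (n : ℕ) (hn : 0 < n) :
    IsSolvable (glToPGLProd n).ker := by
  have : NeZero n := ⟨hn.ne'⟩
  have := Matrix.GeneralLinearGroup.isSolvable_congruenceSubgroup (m := Fin 2)
    (IsNoetherianRing.isNilpotent_nilradical (ZMod n))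
  exact Subgroup.isSolvable_of_commutator_le (commutator_ker_glToPGLProd_le hn.ne')
end

section
/- Let S and T be finite sets of primes with ∅ ≠ S ⊊ T. If the product ∏_{p ∈ T} PGL₂(ℤ/pℤ) has a subquotient isomorphic to PGL₂(ℤ/5ℤ), then at least one of ∏_{p ∈ S} PGL₂(ℤ/pℤ) or ∏_{p ∈ T∖S} PGL₂(ℤ/pℤ) has a subquotient isomorphic to PGL₂(ℤ/5ℤ). -/
open scoped MatrixGroups

open Matrix in
/-- A non-central invertible `2 × 2` matrix over a field is conjugate to the companion matrix of its
characteristic polynomial. -/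
theorem exists_conj_eq_companion {K : Type*} [Field K] {g : GL (Fin 2) K}
    (hg : g ∉ Subgroup.center (GL (Fin 2) K)) :
    ∃ (h : GL (Fin 2) K) (a b : K), (h⁻¹ * g * h).val = !![0, a; 1, b] := by
  suffices H : ∃ (m : Matrix (Fin 2) (Fin 2) K) (a b : K),
      m.det ≠ 0 ∧ g.val * m = m * !![0, a; 1, b] by
    obtain ⟨m, a, b, hm, hgm⟩ := H
    let h := GeneralLinearGroup.mkOfDetNeZero m hm
    refine ⟨h, a, b, ?_⟩
    have hh : (h : Matrix (Fin 2) (Fin 2) K) = m := rfl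
    rw [mul_assoc, Units.val_mul, Units.val_mul, Units.inv_mul_eq_iff_eq_mul, hh, hgm]
  by_cases hr : g.val 1 0 = 0
  · by_cases hq : g.val 0 1 = 0
    · have hps : g.val 1 1 - g.val 0 0 ≠ 0 := by
        intro hps
        refine hg (GeneralLinearGroup.mem_center_iff_val_mem_range_scalar.mpr ⟨g.val 0 0, ?_⟩)
        ext i j
        fin_cases i <;> fin_cases j <;> simp_all [sub_eq_zero]
      refine ⟨!![1, g.val 0 0; 1, g.val 1 1], -g.val.det, g.val.trace, ?_, ?_⟩
      · simpa [det_fin_two] using hps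
      · ext i j
        fin_cases i <;> fin_cases j <;>
          simp [mul_apply, Fin.sum_univ_two, det_fin_two, trace_fin_two, hr, hq] <;> ring
    · refine ⟨!![0, g.val 0 1; 1, g.val 1 1], -g.val.det, g.val.trace, ?_, ?_⟩
      · simpa [det_fin_two] using hq
      · ext i j
        fin_cases i <;> fin_cases j <;>
          simp [mul_apply, Fin.sum_univ_two, det_fin_two, trace_fin_two] <;> ring
  · refine ⟨!![1, g.val 0 0; 0, g.val 1 0], -g.val.det, g.val.trace, ?_, ?_⟩
    · simpa [det_fin_two] using hr
    · ext i j
      fin_cases i <;> fin_cases j <;>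
        simp [mul_apply, Fin.sum_univ_two, det_fin_two, trace_fin_two] <;> ring

/-- Two matrices of `GL₂(K)` whose images in `PGL₂(K)` commute have products with the same
squared entries. -/
theorem PGL2.sq_mul_apply_eq_of_commute {K : Type*} [Field K] {x y : GL (Fin 2) K}
    (h : Commute (x : PGL2 K) (y : PGL2 K)) (i j : Fin 2) :
    ((x * y).val i j) ^ 2 = ((y * x).val i j) ^ 2 := by
  have h' : ((x * y : GL (Fin 2) K) : PGL2 K) = ((y * x : GL (Fin 2) K) : PGL2 K) := h
  rw [QuotientGroup.eq, Matrix.GeneralLinearGroup.mem_center_iff_val_mem_range_scalar] at h'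
  obtain ⟨r, hr⟩ := h'
  have hyx : (y * x).val = (x * y).val * Matrix.scalar (Fin 2) r := by
    rw [hr, ← Units.val_mul, mul_inv_cancel_left]
  have hdet : (x * y).val.det ≠ 0 := ((x * y).isUnit.map Matrix.detMonoidHom).ne_zero
  have hr2 : r ^ 2 = 1 := by
    have := congrArg Matrix.det hyx
    rw [Matrix.det_mul, Units.val_mul, Matrix.det_mul_comm, ← Units.val_mul] at this
    rw [Matrix.scalar_apply, Matrix.det_diagonal, Fin.prod_univ_two, ← sq] at this
    exact mul_left_cancel₀ hdet (by rw [mul_one, ← this])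
  rw [hyx]
  simp [mul_pow, hr2]

/-- In `PGL₂(𝔽₅)`, the centralizer of a nontrivial conjugacy class is trivial. -/
theorem PGL2.eq_one_or_eq_one_of_forall_commute_conj {x y : PGL2 (ZMod 5)}
    (h : ∀ g, Commute x (g * y * g⁻¹)) : x = 1 ∨ y = 1 := by
  have hquad : ∀ a c d : ZMod 5, ∃ t, a ^ 2 ≠ (c + t * d - t ^ 2) ^ 2 := by decide
  have : Fact (Nat.Prime 5) := ⟨by norm_num⟩
  by_contra! hxy
  obtain ⟨x, rfl⟩ := QuotientGroup.mk_surjective x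
  obtain ⟨y, rfl⟩ := QuotientGroup.mk_surjective y
  obtain ⟨k, a, b, hk⟩ := exists_conj_eq_companion
    (fun hx ↦ hxy.1 ((QuotientGroup.eq_one_iff x).mpr hx))
  obtain ⟨l, c, d, hl⟩ := exists_conj_eq_companion
    (fun hy ↦ hxy.2 ((QuotientGroup.eq_one_iff y).mpr hy))
  obtain ⟨t, ht⟩ := hquad a c d
  let u : GL (Fin 2) (ZMod 5) :=
    ⟨!![1, t; 0, 1], !![1, -t; 0, 1], by simp [Matrix.one_fin_two], by simp [Matrix.one_fin_two]⟩
  have hcomm : Commute ((k⁻¹ * x * k : GL (Fin 2) (ZMod 5)) : PGL2 (ZMod 5))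
      ((u * (l⁻¹ * y * l) * u⁻¹ : GL (Fin 2) (ZMod 5)) : PGL2 (ZMod 5)) := by
    have := (Commute.conj_iff (k : PGL2 (ZMod 5))⁻¹).mpr
      (h ((k * u * l⁻¹ : GL (Fin 2) (ZMod 5)) : PGL2 (ZMod 5)))
    convert this using 1
    · simp
    · simp [mul_assoc]
  have := PGL2.sq_mul_apply_eq_of_commute hcomm 0 0
  simp only [Units.val_mul] at hk hl this
  rw [hk, hl] at this
  refine ht ?_
  rw [sub_eq_neg_add, sq t]
  simpa [u, Matrix.mul_apply, Fin.sum_univ_two] using this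

theorem isSubquotient_of_surjective {Γ Q : Type*} [Group Γ] [Group Q] (G : Subgroup Γ)
    (φ : G →* Q) (hφ : Function.Surjective φ) : IsSubquotient Γ Q :=
  ⟨G, φ.ker, inferInstance, ⟨QuotientGroup.quotientKerEquivOfSurjective φ hφ⟩⟩

theorem IsSubquotient.exists_surjective {Γ Q : Type*} [Group Γ] [Group Q]
    (h : IsSubquotient Γ Q) : ∃ (G : Subgroup Γ) (φ : G →* Q), Function.Surjective φ := by
  obtain ⟨G, N, _, ⟨e⟩⟩ := h
  exact ⟨G, e.toMonoidHom.comp (QuotientGroup.mk' N),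
    e.surjective.comp (QuotientGroup.mk'_surjective N)⟩

/-- A quotient of a subgroup `G` of `Γ` that factors through the image of `G` under a homomorphism
to `A` is a subquotient of `A`. -/
theorem isSubquotient_of_ker_le {Γ A Q : Type*} [Group Γ] [Group A] [Group Q] {G : Subgroup Γ}
    {φ : G →* Q} (hφ : Function.Surjective φ) (f : Γ →* A)
    (h : (f.comp G.subtype).ker ≤ φ.ker) : IsSubquotient A Q := by
  let f' := (f.comp G.subtype).rangeRestrict
  have hf' : Function.Surjective f' := MonoidHom.rangeRestrict_surjective _
  have hker : f'.ker ≤ φ.ker := by rwa [MonoidHom.ker_rangeRestrict]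
  refine isSubquotient_of_surjective _ (f'.liftOfSurjective hf' ⟨φ, hker⟩) fun q ↦ ?_
  obtain ⟨g, rfl⟩ := hφ q
  exact ⟨f' g, MonoidHom.liftOfRightInverse_comp_apply _ _ _ _ _⟩

/-- If two homomorphisms out of `Γ` are jointly injective and `Q` has no nontrivial commuting
conjugacy classes, then a subquotient `Q` of `Γ` is a subquotient of one of the two targets. -/
theorem IsSubquotient.or_of_jointly_injective {Γ A B Q : Type*} [Group Γ] [Group A] [Group B]
    [Group Q] (hQ : ∀ x y : Q, (∀ g, Commute x (g * y * g⁻¹)) → x = 1 ∨ y = 1)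
    (f₁ : Γ →* A) (f₂ : Γ →* B) (hf : ∀ x, f₁ x = 1 → f₂ x = 1 → x = 1)
    (h : IsSubquotient Γ Q) : IsSubquotient A Q ∨ IsSubquotient B Q := by
  obtain ⟨G, φ, hφ⟩ := h.exists_surjective
  by_contra! hAB
  have h₁ := mt (isSubquotient_of_ker_le hφ f₁) hAB.1
  have h₂ := mt (isSubquotient_of_ker_le hφ f₂) hAB.2
  obtain ⟨x, hx, hx'⟩ := SetLike.not_le_iff_exists.mp h₁
  obtain ⟨y, hy, hy'⟩ := SetLike.not_le_iff_exists.mp h₂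
  simp only [MonoidHom.mem_ker, MonoidHom.comp_apply, Subgroup.coe_subtype] at hx hx' hy hy'
  refine (hQ (φ x) (φ y) fun q ↦ ?_).elim hx' hy'
  obtain ⟨g, rfl⟩ := hφ q
  have key : Commute x (g * y * g⁻¹) := by
    rw [← commutatorElement_eq_one_iff_commute]
    refine Subtype.ext (hf _ ?_ ?_) <;> simp [commutatorElement_def, hx, hy]
  simpa using key.map φ

/-- Let `S` and `T` be finite sets of primes with `∅ ≠ S ⊊ T`.  If
`∏_{p ∈ T} PGL₂(ℤ/pℤ)` has a subquotient isomorphic to `PGL₂(ℤ/5ℤ)`, then so does at least one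
of `∏_{p ∈ S} PGL₂(ℤ/pℤ)` or `∏_{p ∈ T∖S} PGL₂(ℤ/pℤ)`. -/
theorem pgl2_subquotient_split (S T : Finset ℕ) (hT : ∀ p ∈ T, p.Prime)
    (hS : S.Nonempty) (hST : S ⊂ T)
    (h : IsSubquotient (∀ p : T, PGL2 (ZMod (p : ℕ))) (PGL2 (ZMod 5))) :
    IsSubquotient (∀ p : S, PGL2 (ZMod (p : ℕ))) (PGL2 (ZMod 5)) ∨
      IsSubquotient (∀ p : (T \ S : Finset ℕ), PGL2 (ZMod (p : ℕ))) (PGL2 (ZMod 5)) := by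
  classical
  refine h.or_of_jointly_injective
    (fun _ _ ↦ PGL2.eq_one_or_eq_one_of_forall_commute_conj)
    (MonoidHom.pi fun p : S ↦ Pi.evalMonoidHom _ (⟨p, hST.subset p.2⟩ : T))
    (MonoidHom.pi fun p : (T \ S : Finset ℕ) ↦
      Pi.evalMonoidHom _ (⟨p, (Finset.mem_sdiff.mp p.2).1⟩ : T))
    fun x h₁ h₂ ↦ funext fun p ↦ ?_
  by_cases hp : (p : ℕ) ∈ S
  · exact congrFun h₁ ⟨p, hp⟩
  · exact congrFun h₂ ⟨p, Finset.mem_sdiff.mpr ⟨p.2, hp⟩⟩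
end

section
/- Let ℓ ≥ 5 be a prime, let s and n be positive integers with ℓ ∤ n, and let H be a subgroup of GL₂(ℤ/ℓˢℤ) × GL₂(ℤ/nℤ). Let H_ℓ denote the image of H under the projection to GL₂(ℤ/ℓˢℤ) followed by entrywise reduction GL₂(ℤ/ℓˢℤ) → GL₂(ℤ/ℓℤ). Assume that H_ℓ contains SL₂(ℤ/ℓℤ) if ℓ > 5, and that H_ℓ = GL₂(ℤ/5ℤ) if ℓ = 5. Then for every A ∈ SL₂(ℤ/ℓˢℤ) the element (A, I) lies in H, where I is the identity of GL₂(ℤ/nℤ). In other words, the kernel of the projection H → GL₂(ℤ/nℤ), viewed inside GL₂(ℤ/ℓˢℤ), contains SL₂(ℤ/ℓˢℤ). -/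
open scoped MatrixGroups

section

open scoped commutatorElement

universe u

/-- Modulo `p ^ (i + 1)`, the `p`-th power of `1 + N` with `N ^ 2 = 0` only depends on `N`
modulo `p ^ i`. -/
theorem one_add_pow_prime_of_sq_eq_zero {S : Type*} [Ring S] {p i : ℕ} (hp : p.Prime)
    (h5 : 5 ≤ p) (hi : 0 < i) (h0 : (p : S) ^ (i + 1) = 0) (N B : S) (hN : N * N = 0) :
    (1 + (N + (p : S) ^ i * B)) ^ p = 1 + p * N := by
  have hπ : ∀ z : S, (p : S) ^ i * z = z * (p : S) ^ i := fun z =>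
    ((Nat.cast_commute p z).pow_left i).eq
  have hππ : (p : S) ^ i * (p : S) ^ i = 0 := by
    rw [← pow_add]; exact pow_eq_zero_of_le (by omega) h0
  set π := (p : S) ^ i with hπd
  have hpπ : (p : S) * π = 0 := by rw [hπd, ← pow_succ']; exact h0
  set y := N + π * B with hy
  obtain ⟨c, hc⟩ : ∃ c, y ^ 2 = π * c := by
    refine ⟨N * B + B * N + π * B * B, ?_⟩
    rw [sq, hy, add_mul, mul_add, mul_add, hN, ← mul_assoc N, ← hπ N]
    have : π * B * (π * B) = π * (π * B * B) := by rw [mul_assoc π B, ← mul_assoc B, ← hπ B]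
    rw [this]; noncomm_ring
  have hy4 : y ^ 4 = 0 := by
    rw [show 4 = 2 + 2 from rfl, pow_add, hc, mul_assoc, ← mul_assoc c, ← hπ c, ← mul_assoc,
      ← mul_assoc, hππ, zero_mul, zero_mul]
  have hsum : ∀ k ∈ Finset.range (p + 1), k ∉ Finset.range 2 →
      y ^ k * 1 ^ (p - k) * (p.choose k : S) = 0 := by
    intro k hk hk2
    simp only [Finset.mem_range] at hk hk2
    rcases eq_or_ne k p with rfl | hkp
    · rw [pow_eq_zero_of_le (by omega) hy4]; simp
    · obtain ⟨q, hq⟩ := hp.dvd_choose_self (by omega : k ≠ 0) (by omega : k < p)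
      have hyk : y ^ k = π * (c * y ^ (k - 2)) := by
        rw [← mul_assoc, ← hc, ← pow_add]; congr 1; omega
      rw [hq, one_pow, mul_one, ← Nat.cast_comm, mul_comm p, Nat.cast_mul, hyk, mul_assoc,
        ← mul_assoc (p : S), hpπ, zero_mul, mul_zero]
  rw [add_comm, (Commute.one_right y).add_pow,
    ← Finset.sum_subset (Finset.range_subset_range.2 (by omega)) hsum]
  have : (p : S) * y = p * N := by rw [hy, mul_add, ← mul_assoc, hpπ, zero_mul, add_zero]
  simp [Finset.sum_range_succ, ← this, Nat.cast_comm]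

/-- Over a field, the commutant of a non-scalar `2 × 2` matrix `z` is spanned by `z` and `1`. -/
theorem exists_eq_smul_add_smul_one_of_commute {F : Type*} [Field F]
    {z y : Matrix (Fin 2) (Fin 2) F} (hz : ∀ r : F, z ≠ r • 1) (h : Commute y z) :
    ∃ α β : F, y = α • z + β • 1 := by
  have h00 := congr_fun₂ h.eq 0 0
  have h01 := congr_fun₂ h.eq 0 1
  have h10 := congr_fun₂ h.eq 1 0
  simp only [Matrix.mul_apply, Fin.sum_univ_two] at h00 h01 h10
  suffices ∃ α β : F, y 0 0 = α * z 0 0 + β ∧ y 0 1 = α * z 0 1 ∧ y 1 0 = α * z 1 0 ∧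
      y 1 1 = α * z 1 1 + β by
    obtain ⟨α, β, h1, h2, h3, h4⟩ := this
    refine ⟨α, β, ?_⟩
    ext i j
    fin_cases i <;> fin_cases j <;> simp [h1, h2, h3, h4]
  by_cases hb : z 0 1 = 0
  · by_cases hc : z 1 0 = 0
    · have had : z 0 0 - z 1 1 ≠ 0 := by
        intro hd
        refine hz (z 0 0) ?_
        ext i j
        fin_cases i <;> fin_cases j <;> simp [hb, hc, (sub_eq_zero.1 hd)]
      refine ⟨(y 0 0 - y 1 1) / (z 0 0 - z 1 1),
        y 0 0 - (y 0 0 - y 1 1) / (z 0 0 - z 1 1) * z 0 0, by ring, ?_, ?_, ?_⟩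
      · rw [hb, mul_zero]
        refine (mul_eq_zero.1 (?_ : (z 0 0 - z 1 1) * y 0 1 = 0)).resolve_left had
        rw [hb] at h01
        linear_combination -h01
      · rw [hc, mul_zero]
        refine (mul_eq_zero.1 (?_ : (z 0 0 - z 1 1) * y 1 0 = 0)).resolve_left had
        rw [hc] at h10
        linear_combination h10
      · field_simp
        ring
    · refine ⟨y 1 0 / z 1 0, y 0 0 - y 1 0 / z 1 0 * z 0 0, by ring, ?_, ?_, ?_⟩ <;> field_simp
      · linear_combination h00
      · linear_combination h10
  · refine ⟨y 0 1 / z 0 1, y 0 0 - y 0 1 / z 0 1 * z 0 0, by ring, ?_, ?_, ?_⟩ <;> field_simp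
    · linear_combination -h00
    · linear_combination -h01

/-- A non-scalar `2 × 2` matrix of finite order prime to the characteristic has nonzero
discriminant. -/
theorem trace_sq_sub_four_mul_det_ne_zero {F : Type*} [Field F] [IsAlgClosed F] {m : ℕ}
    (hm : (m : F) ≠ 0) {z : Matrix (Fin 2) (Fin 2) F} (hz : ∀ r : F, z ≠ r • 1)
    (h : z ^ m = 1) : z.trace ^ 2 - 4 * z.det ≠ 0 := by
  intro hd
  obtain ⟨l, hl⟩ := IsAlgClosed.exists_eval₂_eq_zero_of_injective (RingHom.id F)
    Function.injective_id z.charpoly (by rw [Matrix.charpoly_degree_eq_dim]; simp)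
  simp only [Matrix.charpoly_fin_two] at hl
  simp at hl
  have ht : z.trace = 2 * l := by
    have : (z.trace - 2 * l) ^ 2 = 0 := by linear_combination hd + 4 * hl
    exact sub_eq_zero.1 (pow_eq_zero_iff two_ne_zero |>.1 this)
  have hdet : z.det = l ^ 2 := by rw [ht] at hl; linear_combination hl
  have hl0 : l ≠ 0 := by
    rintro rfl
    have := congr_arg Matrix.det h
    rw [Matrix.det_pow, hdet, Matrix.det_one] at this
    have hm0 : m ≠ 0 := by rintro rfl; simp at hm
    simp [hm0] at this
  have hsq : (z - l • 1) * (z - l • 1) = 0 := by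
    have h1 := z.aeval_self_charpoly
    rw [Matrix.charpoly_fin_two, ht, hdet] at h1
    simp [Algebra.algebraMap_eq_smul_one] at h1
    rw [← h1]
    simp only [mul_sub, sub_mul, sq, Matrix.mul_smul, Matrix.smul_mul, mul_one, one_mul]
    module
  set w := z - l • 1 with hw
  have hpow : ∀ k : ℕ, z ^ (k + 1) = l ^ (k + 1) • 1 + ((k + 1 : ℕ) * l ^ k) • w := by
    intro k
    have hzw : z = w + l • 1 := by rw [hw]; abel
    induction k with
    | zero => simp [hzw, add_comm]
    | succ k ih =>
      rw [pow_succ, ih]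
      nth_rw 1 [hzw]
      simp only [mul_add, add_mul, Matrix.mul_smul, Matrix.smul_mul, mul_one, one_mul, hsq]
      push_cast
      module
  obtain ⟨k, rfl⟩ : ∃ k, m = k + 1 := Nat.exists_eq_succ_of_ne_zero (by rintro rfl; simp at hm)
  rw [hpow k] at h
  have hc : ((k + 1 : ℕ) * l ^ k : F) ≠ 0 := mul_ne_zero hm (pow_ne_zero _ hl0)
  set e := ((k + 1 : ℕ) * l ^ k : F)
  refine hz (l + e⁻¹ * (1 - l ^ (k + 1))) ?_
  have hw1 : w = e⁻¹ • (1 - l ^ (k + 1) • 1) := by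
    rw [← eq_sub_of_add_eq' h, smul_smul, inv_mul_cancel₀ hc, one_smul]
  rw [sub_eq_iff_eq_add.1 (hw.symm.trans hw1)]
  module

theorem sq_commute_of_conj_eq_smul_add {F : Type*} [Field F] {x z : Matrix (Fin 2) (Fin 2) F}
    (hx : IsUnit x) {α β : F} (hd : z.trace ^ 2 - 4 * z.det ≠ 0)
    (h : x * z = (α • z + β • 1) * x) : Commute (x ^ 2) z := by
  obtain ⟨x, rfl⟩ := hx
  have hc : (x : Matrix (Fin 2) (Fin 2) F) * z * (x⁻¹ : (Matrix (Fin 2) (Fin 2) F)ˣ)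
      = α • z + β • 1 := by rw [h, mul_assoc, Units.mul_inv, mul_one]
  have htr := congr_arg Matrix.trace hc
  have hdet := congr_arg Matrix.det hc
  rw [Matrix.trace_units_conj] at htr
  rw [Matrix.det_units_conj] at hdet
  simp only [Matrix.trace_fin_two, Matrix.det_fin_two] at htr hdet hd
  simp at htr hdet
  have hα : (1 - α) * (1 + α) = 0 := by
    refine (mul_eq_zero.1 (?_ : _ * ((z 0 0 + z 1 1) ^ 2 -
      4 * (z 0 0 * z 1 1 - z 0 1 * z 1 0)) = 0)).resolve_right hd
    linear_combination -4 * hdet + (2 * β + (z 0 0 + z 1 1) * (1 + α)) * htr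
  have hβ : (α + 1) * β = 0 := by
    rcases mul_eq_zero.1 hα with h1 | h1
    · have : α = 1 := by linear_combination -h1
      subst this
      linear_combination -htr
    · linear_combination β * h1
  have hα2 : α * α = 1 := by linear_combination -hα
  have : (x : Matrix (Fin 2) (Fin 2) F) ^ 2 * z = (α • (α • z + β • 1) + β • 1) * x ^ 2 := by
    rw [sq, mul_assoc, h, ← mul_assoc, mul_add, Matrix.mul_smul, h, Matrix.mul_smul, mul_one]
    simp only [add_mul, Matrix.smul_mul, one_mul, smul_add, mul_assoc]
  rw [commute_iff_eq, this]
  congr 1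
  rw [smul_add, smul_smul, hα2, smul_smul, add_assoc, ← add_smul]
  rw [show α * β + β = (α + 1) * β by ring, hβ, zero_smul, one_smul, add_zero]

/-- A finite `p`-subgroup of `GL₂`, with `p` odd, over a field is abelian. -/
theorem IsPGroup.commute_of_le_GL_two {F : Type*} [Field F] {p : ℕ} (hp : p.Prime) (hp2 : p ≠ 2)
    {Q : Subgroup (GL (Fin 2) F)} [Finite Q] (hQ : IsPGroup p Q)
    {a b : GL (Fin 2) F} (ha : a ∈ Q) (hb : b ∈ Q) : Commute a b := by
  have := Fact.mk hp
  by_cases h : ∃ z ∈ Subgroup.center Q, ∀ r : F,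
      ((z : GL (Fin 2) F) : Matrix (Fin 2) (Fin 2) F) ≠ r • 1
  · obtain ⟨z, hz, hns⟩ := h
    have key : ∀ g ∈ Q, ∃ α β : F, (g : Matrix (Fin 2) (Fin 2) F) =
        α • ((z : GL (Fin 2) F) : Matrix (Fin 2) (Fin 2) F) + β • 1 := fun g hg => by
      refine exists_eq_smul_add_smul_one_of_commute hns ?_
      have := congr_arg (fun t : Q => ((t : GL (Fin 2) F) : Matrix (Fin 2) (Fin 2) F))
        (Subgroup.mem_center_iff.1 hz ⟨g, hg⟩)
      exact this
    obtain ⟨α, β, h1⟩ := key a ha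
    obtain ⟨γ, δ, h2⟩ := key b hb
    refine Units.ext ?_
    rw [Units.val_mul, Units.val_mul, h1, h2]
    simp only [mul_add, add_mul, Matrix.mul_smul, Matrix.smul_mul, mul_one, one_mul]
    module
  · push Not at h
    suffices Subgroup.center Q = ⊤ by
      have := Subgroup.mem_center_iff.1 (this ▸ Subgroup.mem_top (⟨b, hb⟩ : Q)) ⟨a, ha⟩
      exact congr_arg Subtype.val this
    by_contra hne
    have : Nontrivial (Q ⧸ Subgroup.center Q) := QuotientGroup.nontrivial_iff.2 hne
    obtain ⟨q, hq, hq1⟩ := (Subgroup.nontrivial_iff_exists_ne_one _).1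
      (hQ.to_quotient (Subgroup.center Q)).center_nontrivial
    obtain ⟨q, rfl⟩ := QuotientGroup.mk_surjective q
    refine hq1 ((QuotientGroup.eq_one_iff q).2 (Subgroup.mem_center_iff.2 fun g => ?_))
    have hcomm : ⁅g, q⁆ ∈ Subgroup.center Q := by
      rw [← QuotientGroup.eq_one_iff, ← QuotientGroup.mk'_apply, map_commutatorElement,
        commutatorElement_eq_one_iff_commute]
      exact Subgroup.mem_center_iff.1 hq g
    obtain ⟨r, hr⟩ := h _ hcomm
    obtain ⟨k, hk⟩ := hQ ⁅g, q⁆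
    have hdet : r ^ 2 = 1 := by
      have h1 : Matrix.GeneralLinearGroup.det ((⁅g, q⁆ : Q) : GL (Fin 2) F) = 1 := by
        rw [← Subgroup.subtype_apply, map_commutatorElement, map_commutatorElement,
          commutatorElement_eq_one_iff_commute]
        exact Commute.all _ _
      have h2 := congr_arg Units.val h1
      rw [Matrix.GeneralLinearGroup.val_det_apply, hr, Matrix.det_smul] at h2
      simpa using h2
    have hrk : r ^ p ^ k = 1 := by
      have := congr_arg (fun t : Q => ((t : GL (Fin 2) F) : Matrix (Fin 2) (Fin 2) F) 0 0) hk
      simp only [Subgroup.coe_pow, Units.val_pow_eq_pow_val, hr, smul_pow, one_pow] at this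
      simpa using this
    have hr1 : r = 1 := by
      have := pow_gcd_eq_one.2 ⟨hdet, hrk⟩
      rwa [((Nat.coprime_primes Nat.prime_two hp).2 hp2.symm).pow_right k, pow_one] at this
    rw [hr1, one_smul] at hr
    exact (commutatorElement_eq_one_iff_mul_comm.1 (Subtype.ext (Units.ext hr)))

theorem IsPGroup.sq_commute_of_normalizes_field {F : Type*} [Field F] [IsAlgClosed F] {p : ℕ}
    (hp : p.Prime) (hp2 : p ≠ 2) (hpF : (p : F) ≠ 0) {Q : Subgroup (GL (Fin 2) F)} [Finite Q]
    (hQ : IsPGroup p Q) {x y : GL (Fin 2) F} (hx : ∀ q ∈ Q, x * q * x⁻¹ ∈ Q) (hy : y ∈ Q) :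
    Commute (x ^ 2) y := by
  by_cases h : ∃ z ∈ Q, ∀ r : F, (z : Matrix (Fin 2) (Fin 2) F) ≠ r • 1
  · obtain ⟨z, hz, hns⟩ := h
    have key : ∀ g ∈ Q, ∃ α β : F, (g : Matrix (Fin 2) (Fin 2) F) =
        α • (z : Matrix (Fin 2) (Fin 2) F) + β • 1 := fun g hg =>
      exists_eq_smul_add_smul_one_of_commute hns
        ((hQ.commute_of_le_GL_two hp hp2 hg hz).map (Units.coeHom _))
    obtain ⟨α, β, h1⟩ := key _ (hx z hz)
    obtain ⟨γ, δ, h2⟩ := key y hy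
    obtain ⟨k, hk⟩ := hQ ⟨z, hz⟩
    have hdisc := trace_sq_sub_four_mul_det_ne_zero (m := p ^ k) (by simp [hpF]) hns
      (congr_arg (fun t : Q => ((t : GL (Fin 2) F) : Matrix (Fin 2) (Fin 2) F)) hk)
    have hxz : Commute ((x : Matrix (Fin 2) (Fin 2) F) ^ 2) z := by
      refine sq_commute_of_conj_eq_smul_add x.isUnit hdisc (α := α) (β := β) ?_
      rw [← h1, ← Units.val_mul, ← Units.val_mul, inv_mul_cancel_right]
    refine Units.ext ?_
    rw [Units.val_mul, Units.val_mul, h2, Units.val_pow_eq_pow_val]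
    simp only [mul_add, add_mul, Matrix.mul_smul, Matrix.smul_mul, mul_one, one_mul, hxz.eq]
  · push Not at h
    obtain ⟨r, hr⟩ := h y hy
    refine Units.ext ?_
    rw [Units.val_mul, Units.val_mul, hr]
    simp

theorem eq_one_of_pow_eq_one_of_forall_field {R : Type u} {n : Type*} [CommRing R] [Fintype n]
    [DecidableEq n] {m : ℕ} (hm : IsUnit (m : R)) {c : GL n R} (hc : c ^ m = 1)
    (h : ∀ (K : Type u) [Field K] [IsAlgClosed K] (φ : R →+* K),
      Matrix.GeneralLinearGroup.map φ c = 1) : c = 1 := by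
  have hS : IsUnit (∑ i ∈ Finset.range m, (c : Matrix n n R) ^ i) := by
    rw [Matrix.isUnit_iff_isUnit_det]
    by_contra hnu
    obtain ⟨I, hI, hmem⟩ := exists_max_ideal_of_mem_nonunits hnu
    let _ := Ideal.Quotient.field I
    let φ := (algebraMap (R ⧸ I) (AlgebraicClosure (R ⧸ I))).comp (Ideal.Quotient.mk I)
    have h1 : φ.mapMatrix (c : Matrix n n R) = 1 := congr_arg Units.val (h _ φ)
    have h2 : φ (∑ i ∈ Finset.range m, (c : Matrix n n R) ^ i).det = 0 := by
      simp [φ, Ideal.Quotient.eq_zero_iff_mem.2 hmem]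
    rw [RingHom.map_det, map_sum] at h2
    simp only [map_pow, h1, one_pow, Finset.sum_const, Finset.card_range] at h2
    have h3 : φ m ^ Fintype.card n = 0 := by
      simpa [nsmul_eq_mul, ← Matrix.diagonal_natCast] using h2
    exact not_isUnit_zero (h3 ▸ (hm.map φ).pow (Fintype.card n))
  have := geom_sum_mul (c : Matrix n n R) m
  rw [← Units.val_pow_eq_pow_val, hc, Units.val_one, sub_self] at this
  exact Units.ext (sub_eq_zero.1 ((hS.mul_right_eq_zero).1 this))

/-- If `x` normalizes a finite `p`-subgroup `Q` of `GL₂(R)`, where `p` is an odd prime invertible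
in `R`, then `x ^ 2` centralizes `Q`. -/
theorem IsPGroup.sq_commute_of_normalizes {R : Type*} [CommRing R] {p : ℕ}
    (hp : p.Prime) (hp2 : p ≠ 2) (hpR : IsUnit (p : R)) {Q : Subgroup (GL (Fin 2) R)} [Finite Q]
    (hQ : IsPGroup p Q) {x y : GL (Fin 2) R} (hx : ∀ q ∈ Q, x * q * x⁻¹ ∈ Q) (hy : y ∈ Q) :
    Commute (x ^ 2) y := by
  have hc : ⁅x ^ 2, y⁆ ∈ Q := by
    rw [commutatorElement_def, sq]
    have := Q.mul_mem (hx _ (hx _ hy)) (Q.inv_mem hy)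
    simpa [mul_assoc] using this
  obtain ⟨k, hk⟩ := hQ ⟨_, hc⟩
  rw [← commutatorElement_eq_one_iff_commute]
  refine eq_one_of_pow_eq_one_of_forall_field (m := p ^ k) (by simpa using hpR.pow k)
    (congr_arg Subtype.val hk) fun K _ _ φ => ?_
  rw [map_commutatorElement, commutatorElement_eq_one_iff_commute, map_pow]
  have : Finite (Q.map (Matrix.GeneralLinearGroup.map (n := Fin 2) φ)) :=
    (Set.toFinite (Q : Set (GL (Fin 2) R))).image _
  refine (hQ.map (Matrix.GeneralLinearGroup.map φ)).sq_commute_of_normalizes_field hp hp2 ?_ ?_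
    (Subgroup.mem_map_of_mem _ hy)
  · rw [← map_natCast φ]; exact (hpR.map φ).ne_zero
  · rintro _ ⟨q, hq, rfl⟩
    rw [← map_inv, ← map_mul, ← map_mul]
    exact Subgroup.mem_map_of_mem _ (hx q hq)

/-- The case of a normal subgroup in `exists_isPGroup_map_eq`. -/
theorem exists_isPGroup_map_eq_of_normal {G G' : Type*} [Group G] [Finite G] [Group G']
    (f : G →* G') {p : ℕ} [Fact p.Prime] {U : Subgroup G'} [U.Normal] (hU : IsPGroup p U)
    (hUf : U ≤ f.range) (t : G) : ∃ P : Subgroup G, IsPGroup p P ∧ P.map f = U ∧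
      ∃ x : G, (∀ q ∈ P, x * q * x⁻¹ ∈ P) ∧ ∃ u ∈ U, f x = f t * u := by
  let S : Sylow p (U.comap f) := Classical.arbitrary _
  have hsurj : Function.Surjective (f.subgroupComap U) := by
    rintro ⟨u, hu⟩
    obtain ⟨g, rfl⟩ := hUf hu
    exact ⟨⟨g, hu⟩, rfl⟩
  refine ⟨S.map (U.comap f).subtype, S.2.map _, ?_, ?_⟩
  · have htop : (S.mapSurjective hsurj : Subgroup U) = ⊤ := by
      refine (S.mapSurjective hsurj).3 (hU.of_equiv Subgroup.topEquiv.symm) le_top |>.symm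
    rw [Sylow.coe_mapSurjective] at htop
    rw [Subgroup.map_map,
      show f.comp (U.comap f).subtype = U.subtype.comp (f.subgroupComap U) from rfl,
      ← Subgroup.map_map, htop, ← MonoidHom.range_eq_map, Subgroup.range_subtype]
  · obtain ⟨x, hx, m, hm, h⟩ := Subgroup.mem_sup_of_normal_right.1
      (S.normalizer_sup_eq_top.symm ▸ Subgroup.mem_top t :
        t ∈ Subgroup.normalizer (S.map (U.comap f).subtype) ⊔ U.comap f)
    refine ⟨x, fun q hq => (Subgroup.mem_normalizer_iff.1 hx q).1 hq, f m⁻¹,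
      by simpa using hm, ?_⟩
    rw [← map_mul, ← h, mul_inv_cancel_right]

/-- Lifting a `p`-subgroup along a homomorphism, compatibly with an element of its normalizer
(Frattini's argument). -/
theorem exists_isPGroup_map_eq {G G' : Type*} [Group G] [Finite G] [Group G'] (f : G →* G')
    {p : ℕ} [Fact p.Prime] {U : Subgroup G'} (hU : IsPGroup p U) (hUf : U ≤ f.range)
    (t : G) (ht : f t ∈ Subgroup.normalizer (U : Set G')) :
    ∃ P : Subgroup G, IsPGroup p P ∧ P.map f = U ∧
      ∃ x : G, (∀ q ∈ P, x * q * x⁻¹ ∈ P) ∧ ∃ u ∈ U, f x = f t * u := by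
  let V := Subgroup.normalizer (U : Set G')
  obtain ⟨P, hP, hPU, x, hx, ⟨u, huV⟩, hu, hxu⟩ := exists_isPGroup_map_eq_of_normal
    (f.subgroupComap V) (U := U.subgroupOf V)
    (hU.of_equiv (Subgroup.subgroupOfEquivOfLe Subgroup.le_normalizer).symm)
    (by
      rintro ⟨v, hv⟩ (hvU : v ∈ U)
      obtain ⟨g, rfl⟩ := hUf hvU
      exact ⟨⟨g, hv⟩, rfl⟩) ⟨t, ht⟩
  refine ⟨P.map (V.comap f).subtype, hP.map _, ?_, x, ?_, u, hu, congr_arg Subtype.val hxu⟩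
  · rw [Subgroup.map_map,
      show f.comp (V.comap f).subtype = V.subtype.comp (f.subgroupComap V) from rfl,
      ← Subgroup.map_map, hPU, Subgroup.subgroupOf_map_subtype,
      inf_of_le_left Subgroup.le_normalizer]
  · rintro _ ⟨q, hq, rfl⟩
    exact ⟨x * q * x⁻¹, hx q hq, rfl⟩

section
open Matrix Matrix.SpecialLinearGroup

theorem ZMod.exists_eq_mul_of_castHom_eq_zero {m n : ℕ} [NeZero n] (h : m ∣ n) {a : ZMod n}
    (ha : ZMod.castHom h (ZMod m) a = 0) : ∃ b : ZMod n, a = m * b := by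
  rw [← ZMod.natCast_zmod_val a, map_natCast, ZMod.natCast_eq_zero_iff] at ha
  obtain ⟨k, hk⟩ := ha
  exact ⟨k, by rw [← ZMod.natCast_zmod_val a, hk, Nat.cast_mul]⟩

theorem coe_conj_sub_one {n R : Type*} [Fintype n] [DecidableEq n] [CommRing R]
    (g t : SpecialLinearGroup n R) :
    (g * t * g⁻¹).1 - 1 = g.1 * (t.1 - 1) * (g⁻¹).1 := by
  have : g.1 * (g⁻¹).1 = 1 := congr_arg Subtype.val (mul_inv_cancel g)
  rw [mul_sub, mul_one, sub_mul, this]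
  rfl

theorem coe_conj_sub_one_sq {n R : Type*} [Fintype n] [DecidableEq n] [CommRing R]
    (g t : SpecialLinearGroup n R) (h : (t.1 - 1) * (t.1 - 1) = 0) :
    ((g * t * g⁻¹).1 - 1) * ((g * t * g⁻¹).1 - 1) = 0 := by
  have : (g⁻¹).1 * g.1 = 1 := congr_arg Subtype.val (inv_mul_cancel g)
  rw [coe_conj_sub_one, mul_assoc _ (g⁻¹).1, ← mul_assoc (g⁻¹).1, ← mul_assoc (g⁻¹).1, this,
    one_mul, mul_assoc g.1, ← mul_assoc (_ - _), h]
  simp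

theorem transvection_nat_mul {n R : Type*} [Fintype n] [DecidableEq n] [CommRing R] {i j : n}
    (hij : i ≠ j) (k : ℕ) (c : R) : SpecialLinearGroup.transvection hij (k * c) =
      SpecialLinearGroup.transvection hij c ^ k := by
  induction k with
  | zero => simp
  | succ k ih => rw [pow_succ, ← ih, ← transvection_add]; congr 1; push_cast; ring

theorem transvection_sub_one_sq {n R : Type*} [Fintype n] [DecidableEq n] [CommRing R] {i j : n}
    (hij : i ≠ j) (c : R) :
    ((SpecialLinearGroup.transvection hij c).1 - 1) *
      ((SpecialLinearGroup.transvection hij c).1 - 1) = 0 := by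
  rw [transvection_coe, add_sub_cancel_left, single_mul_single_of_ne _ _ _ _ hij.symm]

/-- A matrix of determinant one congruent to `1` modulo a square-zero element `π` is a product of
conjugates of transvections by multiples of `π`. -/
theorem eq_mul_transvection_of_mod_sq {R : Type*} [CommRing R] {π : R} (hππ : π * π = 0)
    (g : SL(2, R)) (C : Matrix (Fin 2) (Fin 2) R) (hg : g.1 = 1 + π • C) :
    g = SpecialLinearGroup.transvection (one_ne_zero (α := Fin 2)) 1 *
          SpecialLinearGroup.transvection (zero_ne_one (α := Fin 2)) (-(π * C 0 0)) *
          (SpecialLinearGroup.transvection (one_ne_zero (α := Fin 2)) 1)⁻¹ *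
        SpecialLinearGroup.transvection (zero_ne_one (α := Fin 2)) (π * (C 0 0 + C 0 1)) *
        SpecialLinearGroup.transvection (one_ne_zero (α := Fin 2)) (π * (C 1 0 - C 0 0)) := by
  have hd := g.2
  rw [hg, det_fin_two] at hd
  simp at hd
  have h01 : ∀ b : R, (SpecialLinearGroup.transvection (zero_ne_one (α := Fin 2)) b).1 =
      !![1, b; 0, 1] := fun b => by
    ext i j; fin_cases i <;> fin_cases j <;> simp [transvection_coe]
  have h10 : ∀ b : R, (SpecialLinearGroup.transvection (one_ne_zero (α := Fin 2)) b).1 =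
      !![1, 0; b, 1] := fun b => by
    ext i j; fin_cases i <;> fin_cases j <;> simp [transvection_coe]
  rw [transvection_inv]
  refine Subtype.ext ?_
  change g.1 = (SpecialLinearGroup.transvection _ _).1 * (SpecialLinearGroup.transvection _ _).1 *
    (SpecialLinearGroup.transvection _ _).1 * (SpecialLinearGroup.transvection _ _).1 *
    (SpecialLinearGroup.transvection _ _).1
  rw [h01, h01, h10, h10, h10, hg]
  ext i j
  fin_cases i <;> fin_cases j <;> simp [Matrix.mul_apply, Fin.sum_univ_two]
  · linear_combination (((1 + π * C 0 0) * (C 0 0 + C 0 1) - C 0 0) * (C 1 0 - C 0 0)) * hππ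
  · linear_combination (-(C 0 0 * (C 0 0 + C 0 1))) * hππ
  · linear_combination (-(C 0 0 * (C 0 0 + C 0 1) * π * (C 1 0 - C 0 0)) +
      C 0 0 * (C 1 0 - C 0 0)) * hππ
  · linear_combination hd + (-(C 0 0 * (C 0 0 + C 0 1)) - C 0 0 * C 1 1 + C 0 1 * C 1 0) * hππ

theorem eq_top_of_map_castHom_pow_eq_top {p s : ℕ} (hp : p.Prime) (h5 : 5 ≤ p) (hs : 0 < s)
    {X : Subgroup SL(2, ZMod (p ^ (s + 1)))}
    (hX : X.map (SpecialLinearGroup.map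
      (ZMod.castHom (pow_dvd_pow p s.le_succ) (ZMod (p ^ s)))) = ⊤) : X = ⊤ := by
  have := NeZero.mk hp.ne_zero
  set φ := ZMod.castHom (pow_dvd_pow p s.le_succ) (ZMod (p ^ s)) with hφ
  have hlift : ∀ g : SL(2, ZMod (p ^ (s + 1))), ∃ x ∈ X, SpecialLinearGroup.map φ x =
      SpecialLinearGroup.map φ g := fun g => Subgroup.mem_map.1 (hX ▸ Subgroup.mem_top _)
  have h0 : (p : ZMod (p ^ (s + 1))) ^ (s + 1) = 0 := by
    rw [← Nat.cast_pow, ZMod.natCast_self]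
  have h0' : (p : Matrix (Fin 2) (Fin 2) (ZMod (p ^ (s + 1)))) ^ (s + 1) = 0 := by
    have := congr_arg (algebraMap _ (Matrix (Fin 2) (Fin 2) (ZMod (p ^ (s + 1))))) h0
    rwa [map_pow, map_natCast, map_zero] at this
  have hker : ∀ x g : SL(2, ZMod (p ^ (s + 1))),
      SpecialLinearGroup.map φ x = SpecialLinearGroup.map φ g →
      ∃ B : Matrix (Fin 2) (Fin 2) (ZMod (p ^ (s + 1))),
        x.1 = g.1 + (p : Matrix (Fin 2) (Fin 2) (ZMod (p ^ (s + 1)))) ^ s * B := by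
    intro x g h
    have : ∀ i j, ∃ b, x i j - g i j = (p ^ s : ℕ) * b := fun i j =>
      ZMod.exists_eq_mul_of_castHom_eq_zero (pow_dvd_pow p s.le_succ) (by
        have := congr_arg (fun t : SL(2, ZMod (p ^ s)) => t i j) h
        rw [map_sub, sub_eq_zero]; exact this)
    choose B hB using this
    refine ⟨Matrix.of B, ?_⟩
    rw [← Nat.cast_pow, ← nsmul_eq_mul]
    ext i j
    rw [Matrix.add_apply, Matrix.smul_apply, nsmul_eq_mul, Matrix.of_apply, ← hB i j,
      add_sub_cancel]
  have hpow : ∀ v : SL(2, ZMod (p ^ (s + 1))),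
      (v.1 - 1) * (v.1 - 1) = 0 → v ^ p ∈ X := by
    intro v hv
    obtain ⟨x, hx, hxv⟩ := hlift v
    obtain ⟨B, hB⟩ := hker x v hxv
    have h1 := one_add_pow_prime_of_sq_eq_zero hp h5 hs h0' _ B hv
    have h2 := one_add_pow_prime_of_sq_eq_zero hp h5 hs h0' _ 0 hv
    rw [← add_assoc, add_sub_cancel, ← hB] at h1
    rw [mul_zero, add_zero, add_sub_cancel, ← h1] at h2
    rw [show v ^ p = x ^ p from Subtype.ext h2]
    exact X.pow_mem hx p
  have htrans : ∀ (g : SL(2, ZMod (p ^ (s + 1)))) {i j : Fin 2} (hij : i ≠ j)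
      (c : ZMod (p ^ (s + 1))),
      g * SpecialLinearGroup.transvection hij (p * c) * g⁻¹ ∈ X := by
    intro g i j hij c
    rw [transvection_nat_mul, ← conj_pow]
    exact hpow _ (coe_conj_sub_one_sq _ _ (transvection_sub_one_sq hij c))
  have hkerX : ∀ g : SL(2, ZMod (p ^ (s + 1))), SpecialLinearGroup.map φ g = 1 → g ∈ X := by
    intro g hg
    obtain ⟨C, hC⟩ := hker g 1 (by rw [hg, map_one])
    obtain ⟨r, rfl⟩ : ∃ r, s = r + 1 := ⟨s - 1, by omega⟩
    set π : ZMod (p ^ (r + 1 + 1)) := (p : ZMod (p ^ (r + 1 + 1))) ^ (r + 1) with hπ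
    have hππ : π * π = 0 := by
      rw [hπ, ← pow_add]; exact pow_eq_zero_of_le (by omega) h0
    have hC' : g.1 = 1 + π • C := by
      rw [hC, ← Nat.cast_pow, ← nsmul_eq_mul, hπ, ← Nat.cast_pow, Nat.cast_smul_eq_nsmul]
      rfl
    have hπ' : ∀ c, π * c = p * (p ^ r * c) := fun c => by
      rw [← mul_assoc]; exact congr_arg (· * c) (pow_succ' _ _)
    clear_value π
    rw [eq_mul_transvection_of_mod_sq hππ g C hC', hπ', hπ', hπ', ← mul_neg]
    refine X.mul_mem (X.mul_mem (htrans _ _ _) ?_) ?_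
    · simpa using htrans 1 zero_ne_one _
    · simpa using htrans 1 one_ne_zero _
  refine eq_top_iff.2 fun g _ => ?_
  obtain ⟨x, hx, h⟩ := hlift g
  rw [← mul_inv_cancel_left x g]
  exact X.mul_mem hx (hkerX _ (by rw [map_mul, map_inv, h, inv_mul_cancel]))

/-- For a prime `p ≥ 5`, a subgroup of `SL₂(ℤ/pˢ)` surjecting onto `SL₂(ℤ/p)` is everything
(Serre). -/
theorem eq_top_of_map_castHom_eq_top {p s : ℕ} (hp : p.Prime) (h5 : 5 ≤ p) (hs : 0 < s)
    {X : Subgroup SL(2, ZMod (p ^ s))}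
    (hX : X.map (SpecialLinearGroup.map (ZMod.castHom (dvd_pow_self p hs.ne') (ZMod p))) = ⊤) :
    X = ⊤ := by
  have := NeZero.mk hp.ne_zero
  induction s, hs using Nat.le_induction with
  | base =>
    refine Subgroup.map_injective (f := SpecialLinearGroup.map
      (ZMod.castHom (dvd_pow_self p one_ne_zero) (ZMod p))) ?_ (hX.trans ?_)
    · refine fun g h hgh => Subtype.ext (Matrix.ext fun i j => sub_eq_zero.1 ?_)
      obtain ⟨b, hb⟩ := ZMod.exists_eq_mul_of_castHom_eq_zero (dvd_pow_self p one_ne_zero)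
        (a := g i j - h i j) (by
          rw [map_sub, sub_eq_zero]
          exact congr_arg (fun t : SL(2, ZMod p) => t i j) hgh)
      rw [hb, ← pow_one (p : ZMod (p ^ 1)), ← Nat.cast_pow, ZMod.natCast_self, zero_mul]
    · exact top_le_iff.1 (hX ▸ Subgroup.map_mono le_top) |>.symm
  | succ s hs ih =>
    refine eq_top_of_map_castHom_pow_eq_top hp h5 hs (ih ?_)
    rw [← hX, Subgroup.map_map]
    congr 1
    ext g i j
    exact RingHom.congr_fun (Subsingleton.elim
      ((ZMod.castHom (dvd_pow_self p (Nat.one_le_iff_ne_zero.1 hs)) (ZMod p)).comp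
        (ZMod.castHom (pow_dvd_pow p s.le_succ) (ZMod (p ^ s))))
      (ZMod.castHom (dvd_pow_self p s.succ_ne_zero) (ZMod p))) (g.1 i j)

/-- The homomorphism from the additive group of `R` to the upper unipotent matrices in `GL₂(R)`. -/
def upperUnipotentHom (R : Type*) [CommRing R] : Multiplicative R →* GL (Fin 2) R where
  toFun c := toGL (SpecialLinearGroup.transvection (zero_ne_one (α := Fin 2)) c.toAdd)
  map_one' := by simp
  map_mul' a b := by rw [toAdd_mul, transvection_add, map_mul]

/-- A normal subgroup of `SL₂(𝔽_p)` containing a nontrivial transvection is everything. -/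
theorem Subgroup.eq_top_of_transvection_mem {p : ℕ} [Fact p.Prime] {K : Subgroup SL(2, ZMod p)}
    (hK : K.Normal) {d : ZMod p} (hd : d ≠ 0)
    (h : SpecialLinearGroup.transvection (zero_ne_one (α := Fin 2)) d ∈ K) : K = ⊤ := by
  have h01 : ∀ b : ZMod p, SpecialLinearGroup.transvection (zero_ne_one (α := Fin 2)) b ∈ K := by
    intro b
    rw [← div_mul_cancel₀ b hd, ← ZMod.natCast_zmod_val (b / d), transvection_nat_mul]
    exact K.pow_mem h _
  have h10 : ∀ b : ZMod p, SpecialLinearGroup.transvection (one_ne_zero (α := Fin 2)) b ∈ K := by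
    intro b
    let w : SL(2, ZMod p) := ⟨!![0, -1; 1, 0], by simp⟩
    have := hK.conj_mem _ (h01 (-b)) w
    convert this using 1
    rw [eq_mul_inv_iff_mul_eq]
    refine Subtype.ext ?_
    change (SpecialLinearGroup.transvection _ _).1 * !![0, -1; 1, 0] =
      !![0, -1; 1, 0] * (SpecialLinearGroup.transvection _ _).1
    ext i j
    fin_cases i <;> fin_cases j <;> simp [Matrix.mul_apply, Fin.sum_univ_two, transvection_coe]
  refine eq_top_iff.2 fun g _ => Matrix.SL2.transvection_induction (· ∈ K) ?_
    (fun _ _ => K.mul_mem) g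
  intro i j hij c
  fin_cases i <;> fin_cases j
  · exact absurd rfl hij
  · exact h01 c
  · exact h10 c
  · exact absurd rfl hij

/-- The elements `A` of `SL₂(R)` such that `(A, 1)` lies in `H`. -/
def slLeftKer {R R' : Type*} [CommRing R] [CommRing R']
    (H : Subgroup (GL (Fin 2) R × GL (Fin 2) R')) : Subgroup SL(2, R) :=
  H.comap ((MonoidHom.inl _ _).comp toGL)

theorem mem_slLeftKer {R R' : Type*} [CommRing R] [CommRing R']
    {H : Subgroup (GL (Fin 2) R × GL (Fin 2) R')} {A : SL(2, R)} :
    A ∈ slLeftKer H ↔ (toGL A, 1) ∈ H := Iff.rfl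

theorem exists_toGL_eq_of_det_eq_one {R : Type*} [CommRing R] {g : GL (Fin 2) R}
    (hg : Matrix.GeneralLinearGroup.det g = 1) : ∃ A : SL(2, R), toGL A = g :=
  ⟨⟨g.1, congr_arg Units.val hg⟩, Units.ext rfl⟩

theorem toGL_map {R S : Type*} [CommRing R] [CommRing S] (φ : R →+* S) (A : SL(2, R)) :
    toGL (SpecialLinearGroup.map φ A) = GeneralLinearGroup.map φ (toGL A) := Units.ext rfl

theorem map_slLeftKer_normal {R R' S : Type*} [CommRing R] [CommRing R'] [CommRing S]
    (φ : R →+* S) (H : Subgroup (GL (Fin 2) R × GL (Fin 2) R'))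
    (hH : (toGL (n := Fin 2) (R := S)).range ≤
      H.map ((GeneralLinearGroup.map φ).comp (MonoidHom.fst _ _))) :
    ((slLeftKer H).map (SpecialLinearGroup.map φ)).Normal := by
  refine ⟨?_⟩
  rintro _ ⟨A, hA, rfl⟩ g
  obtain ⟨h, hh, hg⟩ := hH ⟨g, rfl⟩
  obtain ⟨B, hB⟩ := exists_toGL_eq_of_det_eq_one (g := h.1 * toGL A * h.1⁻¹) (by
    rw [map_mul, map_mul, map_inv, mul_inv_cancel_comm]
    exact Units.ext A.2)
  refine ⟨B, ?_, ?_⟩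
  · refine mem_slLeftKer.2 ?_
    have := H.mul_mem (H.mul_mem hh (mem_slLeftKer.1 hA)) (H.inv_mem hh)
    rw [hB]
    convert this using 1
    exact Prod.ext rfl (by simp)
  · refine toGL_injective ?_
    rw [toGL_map, hB, map_mul, map_mul, map_inv, map_mul, map_mul, map_inv, toGL_map]
    rw [← hg]
    rfl

/-- If the mod `p` image of the first component of `H` contains `SL₂(𝔽_p)` together with an element
scaling the upper unipotent matrices by `κ` with `κ ^ 2 ≠ 1`, then `slLeftKer H` surjects onto
`SL₂(𝔽_p)`. -/
theorem map_slLeftKer_eq_top {R R' : Type*} [CommRing R] [Finite R] [CommRing R'] [Finite R']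
    {p : ℕ} (hp : p.Prime) (hp2 : p ≠ 2) (hpR : IsUnit (p : R')) (φ : R →+* ZMod p)
    (H : Subgroup (GL (Fin 2) R × GL (Fin 2) R'))
    (hH : (toGL (n := Fin 2) (R := ZMod p)).range ≤
      H.map ((GeneralLinearGroup.map φ).comp (MonoidHom.fst _ _)))
    {τ : GL (Fin 2) (ZMod p)}
    (hτ : τ ∈ H.map ((GeneralLinearGroup.map φ).comp (MonoidHom.fst _ _))) {κ : ZMod p}
    (hκ : κ ^ 2 ≠ 1) (hκ0 : κ ≠ 0) (hτκ : ∀ c, τ * upperUnipotentHom _ (.ofAdd c) * τ⁻¹ =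
      upperUnipotentHom _ (.ofAdd (κ * c))) :
    (slLeftKer H).map (SpecialLinearGroup.map φ) = ⊤ := by
  have := Fact.mk hp
  let f : H →* GL (Fin 2) (ZMod p) :=
    ((GeneralLinearGroup.map φ).comp (MonoidHom.fst _ _)).comp H.subtype
  have hf : f.range = H.map ((GeneralLinearGroup.map φ).comp (MonoidHom.fst _ _)) := by
    rw [MonoidHom.range_comp, Subgroup.range_subtype]
  rw [← hf] at hτ
  obtain ⟨t, rfl⟩ := hτ
  have hU : IsPGroup p (upperUnipotentHom (ZMod p)).range := by
    have h : IsPGroup p (Multiplicative (ZMod p)) := IsPGroup.of_card (n := 1) (by simp)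
    exact h.of_surjective _ (upperUnipotentHom (ZMod p)).rangeRestrict_surjective
  obtain ⟨P, hP, hPU, x, hx, _, ⟨v, rfl⟩, hxu⟩ := exists_isPGroup_map_eq f hU
    (by
      rw [hf]
      rintro _ ⟨c, rfl⟩
      exact hH ⟨_, rfl⟩) t (by
      refine Subgroup.mem_normalizer_iff.2 fun g => ⟨?_, ?_⟩
      · rintro ⟨c, rfl⟩
        exact ⟨.ofAdd (κ * c.toAdd), (hτκ c.toAdd).symm⟩
      · rintro ⟨c, hc⟩
        refine ⟨.ofAdd (κ⁻¹ * c.toAdd), ?_⟩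
        have h1 := hτκ (κ⁻¹ * c.toAdd)
        rw [mul_inv_cancel_left₀ hκ0] at h1
        exact mul_left_cancel (mul_right_cancel (h1.trans hc)))
  obtain ⟨y, hy, hfy⟩ : upperUnipotentHom _ (.ofAdd 1) ∈ P.map f := hPU ▸ ⟨_, rfl⟩
  have hxc : ∀ c, f x * upperUnipotentHom _ (.ofAdd c) * (f x)⁻¹ =
      upperUnipotentHom _ (.ofAdd (κ * c)) := by
    intro c
    rw [← hτκ, hxu, _root_.mul_inv_rev, mul_assoc _ (upperUnipotentHom _ v), ← map_mul, mul_comm v,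
      map_mul]
    group
  have hcomm : Commute (x.1.2 ^ 2) y.1.2 := by
    refine IsPGroup.sq_commute_of_normalizes hp hp2 hpR
      (Q := P.map ((MonoidHom.snd _ _).comp H.subtype)) (hP.map _) ?_ ⟨y, hy, rfl⟩
    rintro _ ⟨q, hq, rfl⟩
    exact ⟨_, hx q hq, rfl⟩
  obtain ⟨B, hB⟩ := exists_toGL_eq_of_det_eq_one (g := (⁅x ^ 2, y⁆ : H).1.1) (by
    change (GeneralLinearGroup.det.comp ((MonoidHom.fst _ _).comp H.subtype)) ⁅x ^ 2, y⁆ = 1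
    rw [map_commutatorElement]
    exact commutatorElement_eq_one_iff_commute.2 (Commute.all _ _))
  refine Subgroup.eq_top_of_transvection_mem (map_slLeftKer_normal φ H hH)
    (sub_ne_zero.2 hκ) ⟨B, ?_, ?_⟩
  · refine mem_slLeftKer.2 ?_
    convert (⁅x ^ 2, y⁆ : H).2 using 1
    exact Prod.ext hB (commutatorElement_eq_one_iff_commute.2 hcomm).symm
  · refine toGL_injective ?_
    rw [toGL_map, hB]
    change f ⁅x ^ 2, y⁆ = upperUnipotentHom _ (.ofAdd (κ ^ 2 - 1))
    rw [map_commutatorElement, map_pow, hfy, commutatorElement_def, sub_eq_add_neg, ofAdd_add,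
      map_mul, ofAdd_neg, map_inv, sq, sq, ← mul_one (κ * κ), mul_assoc κ, ← hxc, ← hxc]
    group

end

end

/-- Proposition 3.2 of the paper.  Let `ℓ ≥ 5` be a prime, `s, n` positive
integers with `ℓ ∤ n`, and `H ≤ GL₂(ℤ/ℓˢℤ) × GL₂(ℤ/nℤ)`.  Write `H_ℓ` for the image of `H`
under the first projection followed by reduction mod `ℓ`.  If `H_ℓ ⊇ SL₂(ℤ/ℓℤ)` when `ℓ > 5`
and `H_ℓ = GL₂(ℤ/5ℤ)` when `ℓ = 5`, then `(A, I) ∈ H` for every `A ∈ SL₂(ℤ/ℓˢℤ)`; that is,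
the kernel of the projection `H → GL₂(ℤ/nℤ)`, viewed inside `GL₂(ℤ/ℓˢℤ)`, contains
`SL₂(ℤ/ℓˢℤ)`. -/
theorem sl2_le_ker_of_large_mod_ell_image (ℓ s n : ℕ) (hℓ : ℓ.Prime) (h5 : 5 ≤ ℓ)
    (hs : 0 < s) (hn : 0 < n) (hℓn : ¬ ℓ ∣ n)
    (H : Subgroup (GL (Fin 2) (ZMod (ℓ ^ s)) × GL (Fin 2) (ZMod n)))
    (hgt : 5 < ℓ →
      (Matrix.SpecialLinearGroup.toGL (n := Fin 2) (R := ZMod ℓ)).range ≤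
        H.map ((Matrix.GeneralLinearGroup.map
            (ZMod.castHom (dvd_pow_self ℓ hs.ne') (ZMod ℓ))).comp
          (MonoidHom.fst (GL (Fin 2) (ZMod (ℓ ^ s))) (GL (Fin 2) (ZMod n)))))
    (heq : ℓ = 5 →
      H.map ((Matrix.GeneralLinearGroup.map
          (ZMod.castHom (dvd_pow_self ℓ hs.ne') (ZMod ℓ))).comp
        (MonoidHom.fst (GL (Fin 2) (ZMod (ℓ ^ s))) (GL (Fin 2) (ZMod n)))) = ⊤) :
    ∀ A : Matrix.SpecialLinearGroup (Fin 2) (ZMod (ℓ ^ s)),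
      (Matrix.SpecialLinearGroup.toGL A, (1 : GL (Fin 2) (ZMod n))) ∈ H := by
  have := Fact.mk hℓ
  have := NeZero.mk hn.ne'
  have := NeZero.mk hℓ.ne_zero
  have hunit : IsUnit (ℓ : ZMod n) :=
    (ZMod.isUnit_iff_coprime ℓ n).2 ((Nat.Prime.coprime_iff_not_dvd hℓ).2 hℓn)
  have hnat : ∀ k : ℕ, 0 < k → k < ℓ → (k : ZMod ℓ) ≠ 0 := fun k hk hkl h =>
    Nat.not_dvd_of_pos_of_lt hk hkl ((ZMod.natCast_eq_zero_iff _ _).1 h)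
  have h2 : (2 : ZMod ℓ) ≠ 0 := mod_cast hnat 2 (by omega) (by omega)
  have h3 : (3 : ZMod ℓ) ≠ 0 := mod_cast hnat 3 (by omega) (by omega)
  suffices h : slLeftKer H = ⊤ from fun A => mem_slLeftKer.1 (h ▸ Subgroup.mem_top A)
  refine eq_top_of_map_castHom_eq_top hℓ h5 hs ?_
  have htransv : ∀ b : ZMod ℓ, (upperUnipotentHom (ZMod ℓ) (.ofAdd b)).1 = !![1, b; 0, 1] := by
    intro b
    ext i j
    fin_cases i <;> fin_cases j <;>
      simp [upperUnipotentHom, Matrix.SpecialLinearGroup.transvection_coe]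
  rcases h5.lt_or_eq with h | h
  · have h5' : (5 : ZMod ℓ) ≠ 0 := mod_cast hnat 5 (by omega) (by omega)
    let τ : SL(2, ZMod ℓ) := ⟨!![2, 0; 0, 2⁻¹], by simp [h2]⟩
    refine map_slLeftKer_eq_top hℓ (by omega) hunit _ H (hgt h) (hgt h ⟨τ, rfl⟩) (κ := 4) ?_ ?_ ?_
    · rw [Ne, ← sub_eq_zero]
      convert mul_ne_zero h3 h5' using 1
      norm_num
    · convert mul_ne_zero h2 h2 using 1
      norm_num
    · intro c
      rw [mul_inv_eq_iff_eq_mul]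
      refine Units.ext ?_
      change !![2, 0; 0, 2⁻¹] * (upperUnipotentHom (ZMod ℓ) (.ofAdd c)).1 =
        (upperUnipotentHom (ZMod ℓ) (.ofAdd (4 * c))).1 * !![2, 0; 0, 2⁻¹]
      rw [htransv, htransv]
      ext i j
      fin_cases i <;> fin_cases j <;> simp [Matrix.mul_apply, Fin.sum_univ_two]
      field_simp
      ring
  · let τ : GL (Fin 2) (ZMod ℓ) :=
      Matrix.GeneralLinearGroup.mkOfDetNeZero !![2, 0; 0, 1] (by simpa using h2)
    have hH := heq h.symm
    refine map_slLeftKer_eq_top hℓ (by omega) hunit _ H (hH ▸ le_top)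
      (hH ▸ Subgroup.mem_top τ) (κ := 2) ?_ h2 ?_
    · rw [Ne, ← sub_eq_zero]
      convert h3 using 1
      norm_num
    · intro c
      rw [mul_inv_eq_iff_eq_mul]
      refine Units.ext ?_
      change !![2, 0; 0, 1] * (upperUnipotentHom (ZMod ℓ) (.ofAdd c)).1 =
        (upperUnipotentHom (ZMod ℓ) (.ofAdd (2 * c))).1 * !![2, 0; 0, 1]
      rw [htransv, htransv]
      ext i j
      fin_cases i <;> fin_cases j <;> simp [Matrix.mul_apply, Fin.sum_univ_two]
end

section
/- Let ℓ be a prime and let G be a closed subgroup of GL₂(ℤ_ℓ), where GL₂(ℤ_ℓ) carries its natural topology as the unit group of the 2×2 matrix ring over the ℓ-adic integers. Set s₀ = 1 if ℓ is odd and s₀ = 2 if ℓ = 2. Suppose that for some integer s ≥ s₀ the following holds: every element of GL₂(ℤ/ℓ^{s+1}ℤ) whose entrywise reduction modulo ℓˢ is the identity matrix lies in the image of G under the reduction map GL₂(ℤ_ℓ) → GL₂(ℤ/ℓ^{s+1}ℤ). Then every element of GL₂(ℤ_ℓ) whose entrywise reduction modulo ℓˢ is the identity matrix lies in G; that is, the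 kernel of G → (G mod ℓˢ) equals I + ℓˢ·M₂(ℤ_ℓ). -/
open scoped MatrixGroups

/-- The binomial expansion of `(1 + y) ^ m` up to terms of degree three. -/
theorem exists_one_add_pow_eq_add_pow_three_mul {R : Type*} [Ring R] (y : R) (m : ℕ) :
    ∃ z, (1 + y) ^ m = 1 + m • y + m.choose 2 • y ^ 2 + y ^ 3 * z := by
  induction m with
  | zero => exact ⟨0, by simp⟩
  | succ m ih =>
    obtain ⟨z, hz⟩ := ih
    refine ⟨m.choose 2 • 1 + z * (1 + y), ?_⟩
    rw [pow_succ, hz, Nat.choose_succ_succ' m 1, Nat.choose_one_right]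
    simp only [nsmul_eq_mul, Nat.cast_add, Nat.cast_one]
    have h2 := (Nat.cast_commute (m.choose 2) y).eq
    have h3 := (Nat.cast_commute (m.choose 2) (y ^ 3)).eq
    rw [mul_add (y ^ 3), mul_one, ← h3]
    noncomm_ring

/-- If `x = 1 + p ^ n u`, with `n ≥ 1` and `n ≥ 2` for `p = 2`, then
`x ^ p ≡ 1 + p ^ (n + 1) u` modulo `p ^ (n + 2)`. -/
theorem exists_one_add_smul_pow_prime_eq {S A : Type*} [CommRing S] [Ring A] [Algebra S A]
    {p : ℕ} (hp : p.Prime) {n : ℕ} (hn : (if p = 2 then 2 else 1) ≤ n) (u : A) :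
    ∃ v : A, (1 + (p ^ n : S) • u) ^ p = 1 + (p ^ (n + 1) : S) • (u + (p : S) • v) := by
  obtain ⟨z, hz⟩ := exists_one_add_pow_eq_add_pow_three_mul ((p ^ n : S) • u) p
  have hchoose : ∃ c : ℕ, p.choose 2 * p ^ (2 * n) = p ^ (n + 2) * c := by
    split_ifs at hn with h2
    · subst h2
      exact ⟨2 ^ (n - 2), by rw [Nat.choose_self, one_mul, ← pow_add]; congr 1; omega⟩
    · obtain ⟨c, hc⟩ := hp.dvd_choose_self two_ne_zero (lt_of_le_of_ne hp.two_le (Ne.symm h2))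
      obtain ⟨k, rfl⟩ := Nat.exists_eq_add_of_le hn
      exact ⟨c * p ^ k, by rw [hc]; ring⟩
  obtain ⟨c, hc⟩ := hchoose
  obtain ⟨k, hk⟩ : ∃ k, 3 * n = n + 2 + k :=
    Nat.exists_eq_add_of_le (by split_ifs at hn <;> omega)
  have hc' : (p.choose 2 : S) * (p ^ n) ^ 2 = p ^ (n + 1) * (p * c) := by
    have := congrArg (Nat.cast : ℕ → S) hc
    push_cast at this
    linear_combination this
  have hk' : ((p : S) ^ n) ^ 3 = p ^ (n + 1) * (p * p ^ k) := by
    rw [← pow_mul, mul_comm n, hk]; ring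
  refine ⟨(c : S) • u ^ 2 + (p ^ k : S) • (u ^ 3 * z), ?_⟩
  rw [hz, smul_pow, smul_pow, hk', ← Nat.cast_smul_eq_nsmul S p,
    ← Nat.cast_smul_eq_nsmul S (p.choose 2), smul_smul, smul_smul, hc', smul_mul_assoc]
  simp only [smul_add, smul_smul]
  rw [← pow_succ' (p : S) n, add_assoc, add_assoc]

namespace PadicInt

variable {p : ℕ} [Fact p.Prime] {m : Type*} [Fintype m] [DecidableEq m]

theorem toZModPow_eq_toZModPow_iff {n : ℕ} {x y : ℤ_[p]} :
    toZModPow n x = toZModPow n y ↔ (p ^ n : ℤ_[p]) ∣ x - y := by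
  rw [← Ideal.mem_span_singleton, ← ker_toZModPow, RingHom.mem_ker, map_sub, sub_eq_zero]

/-- Two invertible matrices agree modulo `p ^ n` exactly when they differ by `p ^ n E`. -/
theorem generalLinearGroup_map_toZModPow_eq_iff {n : ℕ} {g h : GL m ℤ_[p]} :
    Matrix.GeneralLinearGroup.map (toZModPow n) g = Matrix.GeneralLinearGroup.map (toZModPow n) h ↔
      ∃ E : Matrix m m ℤ_[p], g.val = h.val + (p ^ n : ℤ_[p]) • E := by
  rw [Units.ext_iff, ← Matrix.ext_iff]
  simp only [Matrix.GeneralLinearGroup.map_apply, toZModPow_eq_toZModPow_iff]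
  constructor
  · intro H
    choose E hE using H
    refine ⟨Matrix.of E, ?_⟩
    ext i j
    simp [← hE]
  · rintro ⟨E, hE⟩ i j
    exact ⟨E i j, by simp [hE]⟩

theorem isUnit_one_add_pow_smul {n : ℕ} (hn : n ≠ 0) (B : Matrix m m ℤ_[p]) :
    IsUnit (1 + (p ^ n : ℤ_[p]) • B) := by
  rw [Matrix.isUnit_iff_isUnit_det]
  have : IsLocalHom (toZMod : ℤ_[p] →+* ZMod p) :=
    IsLocalHom.of_surjective _ (ZMod.ringHom_surjective _)
  refine isUnit_of_map_unit (toZMod : ℤ_[p] →+* ZMod p) _ ?_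
  have h : (toZMod : ℤ_[p] →+* ZMod p).mapMatrix (1 + (p ^ n : ℤ_[p]) • B) = 1 := by
    ext i j
    simp [hn, Matrix.one_apply, apply_ite]
  rw [RingHom.map_det, h, Matrix.det_one]
  exact isUnit_one

/-- An invertible matrix that is congruent modulo every power of `p` to an element of a closed
subset lies in that subset. -/
theorem mem_of_isClosed_of_forall_map_toZModPow_eq {G : Set (GL m ℤ_[p])} (hG : IsClosed G)
    {h : GL m ℤ_[p]}
    (H : ∀ n, ∃ g ∈ G, Matrix.GeneralLinearGroup.map (toZModPow n) g =
      Matrix.GeneralLinearGroup.map (toZModPow n) h) : h ∈ G := by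
  choose g hgG hg using H
  have key : ∀ f : ℕ → GL m ℤ_[p], ∀ k : GL m ℤ_[p],
      (∀ n, Matrix.GeneralLinearGroup.map (toZModPow n) (f n) =
        Matrix.GeneralLinearGroup.map (toZModPow n) k) →
      Filter.Tendsto (fun n => (f n).val) Filter.atTop (nhds k.val) := by
    intro f k hf
    refine tendsto_pi_nhds.2 fun i => tendsto_pi_nhds.2 fun j => ?_
    rw [tendsto_iff_norm_sub_tendsto_zero]
    have hp : (1 : ℝ) < p := mod_cast (Fact.out : p.Prime).one_lt
    refine squeeze_zero (fun _ => norm_nonneg _) (fun n => ?_)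
      (tendsto_pow_atTop_nhds_zero_of_lt_one (inv_nonneg.2 (zero_le_one.trans hp.le))
        (inv_lt_one_of_one_lt₀ hp))
    obtain ⟨E, hE⟩ := generalLinearGroup_map_toZModPow_eq_iff.1 (hf n)
    have : (f n).val i j - k.val i j = p ^ n * E i j := by simp [hE]
    rw [this, norm_mul, norm_pow, norm_p]
    exact mul_le_of_le_one_right (by positivity) (norm_le_one _)
  refine hG.mem_of_tendsto (b := Filter.atTop) (f := g) ?_ (Filter.Eventually.of_forall hgG)
  rw [Units.isEmbedding_embedProduct.tendsto_nhds_iff]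
  refine (key g h hg).prodMk_nhds ((MulOpposite.continuous_op.tendsto _).comp
    (key (fun n => (g n)⁻¹) h⁻¹ fun n => ?_))
  rw [map_inv, map_inv, hg]

end PadicInt

/-- Lang–Trotter; Proposition 3.4 of the paper.  Let `ℓ` be a prime and `G`
a closed subgroup of `GL₂(ℤ_ℓ)`.  Set `s₀ = 1` for `ℓ` odd and `s₀ = 2` for `ℓ = 2`.  If for
some `s ≥ s₀` every element of `GL₂(ℤ/ℓ^{s+1}ℤ)` reducing to the identity mod `ℓˢ` lies in
the image of `G` mod `ℓ^{s+1}`, then every element of `GL₂(ℤ_ℓ)` reducing to the identity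
mod `ℓˢ` lies in `G`, i.e. `ker (G → G mod ℓˢ) = I + ℓˢ·M₂(ℤ_ℓ)`. -/
theorem langTrotter_full_congruence_kernel (ℓ : ℕ) [Fact ℓ.Prime]
    (G : Subgroup (GL (Fin 2) ℤ_[ℓ])) (hG : IsClosed (G : Set (GL (Fin 2) ℤ_[ℓ])))
    (s : ℕ) (hs : (if ℓ = 2 then 2 else 1) ≤ s)
    (hker : ∀ x : GL (Fin 2) (ZMod (ℓ ^ (s + 1))),
      Matrix.GeneralLinearGroup.map
          (ZMod.castHom (pow_dvd_pow ℓ (Nat.le_succ s)) (ZMod (ℓ ^ s))) x = 1 →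
        x ∈ G.map (Matrix.GeneralLinearGroup.map (PadicInt.toZModPow (s + 1)))) :
    ∀ g : GL (Fin 2) ℤ_[ℓ],
      Matrix.GeneralLinearGroup.map (PadicInt.toZModPow s) g = 1 → g ∈ G := by
  have hs0 : s ≠ 0 := by split_ifs at hs <;> omega
  have layer : ∀ n, s ≤ n → ∀ B : Matrix (Fin 2) (Fin 2) ℤ_[ℓ], ∃ g ∈ G,
      ∃ C, g.val = 1 + (ℓ ^ n : ℤ_[ℓ]) • (B + (ℓ : ℤ_[ℓ]) • C) := by
    intro n hn
    induction n, hn using Nat.le_induction with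
    | base =>
      intro B
      obtain ⟨u, hu⟩ := PadicInt.isUnit_one_add_pow_smul hs0 B
      obtain ⟨g, hgG, hg⟩ := hker (Matrix.GeneralLinearGroup.map (PadicInt.toZModPow (s + 1)) u) (by
        rw [← MonoidHom.comp_apply, ← Matrix.GeneralLinearGroup.map_comp,
          PadicInt.zmod_cast_comp_toZModPow s (s + 1) (Nat.le_succ s),
          ← map_one (Matrix.GeneralLinearGroup.map (PadicInt.toZModPow s)),
          PadicInt.generalLinearGroup_map_toZModPow_eq_iff]
        exact ⟨B, hu⟩)
      obtain ⟨C, hC⟩ := PadicInt.generalLinearGroup_map_toZModPow_eq_iff.1 hg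
      exact ⟨g, hgG, C, by rw [hC, hu, pow_succ, mul_smul, smul_add, add_assoc]⟩
    | succ n hn ih =>
      intro B
      obtain ⟨g, hgG, C, hC⟩ := ih B
      obtain ⟨D, hD⟩ := exists_one_add_smul_pow_prime_eq (S := ℤ_[ℓ]) (Fact.out : ℓ.Prime)
        (hs.trans hn) (B + (ℓ : ℤ_[ℓ]) • C)
      exact ⟨g ^ ℓ, G.pow_mem hgG ℓ, C + D, by
        rw [Units.val_pow_eq_pow_val, hC, hD, smul_add (ℓ : ℤ_[ℓ]), add_assoc B]⟩
  intro h hh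
  have approx : ∀ n, s ≤ n → ∃ g ∈ G, Matrix.GeneralLinearGroup.map (PadicInt.toZModPow n) g =
      Matrix.GeneralLinearGroup.map (PadicInt.toZModPow n) h := by
    intro n hn
    induction n, hn using Nat.le_induction with
    | base => exact ⟨1, G.one_mem, by rw [hh, map_one]⟩
    | succ n hn ih =>
      obtain ⟨g, hgG, hg⟩ := ih
      obtain ⟨E, hE⟩ := PadicInt.generalLinearGroup_map_toZModPow_eq_iff.1 hg.symm
      obtain ⟨k, hkG, C, hC⟩ := layer n hn (g⁻¹.val * E)
      refine ⟨g * k, G.mul_mem hgG hkG, PadicInt.generalLinearGroup_map_toZModPow_eq_iff.2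
        ⟨g.val * C, ?_⟩⟩
      rw [Units.val_mul, hC, hE, pow_succ, mul_smul, mul_add, mul_one, mul_smul_comm, mul_add,
        Units.mul_inv_cancel_left, mul_smul_comm, smul_add, add_assoc]
  refine PadicInt.mem_of_isClosed_of_forall_map_toZModPow_eq hG fun n => ?_
  obtain ⟨g, hgG, hg⟩ := approx (max s n) (le_max_left s n)
  refine ⟨g, hgG, ?_⟩
  have := congrArg (Matrix.GeneralLinearGroup.map
    (ZMod.castHom (pow_dvd_pow ℓ (le_max_right s n)) (ZMod (ℓ ^ n)))) hg
  rwa [← MonoidHom.comp_apply, ← MonoidHom.comp_apply, ← Matrix.GeneralLinearGroup.map_comp,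
    PadicInt.zmod_cast_comp_toZModPow n _ (le_max_right s n)] at this
end

section
/- Let ℓ₁, …, ℓ_q be distinct primes and let t₁, …, t_q be positive integers. Let G be a closed subgroup of the product ∏_{i=1}^q GL₂(ℤ_{ℓᵢ}) (with the product topology). For each i, let π_i : ∏_{j=1}^q GL₂(ℤ_{ℓⱼ}) → (∏_{j ≠ i} GL₂(ℤ/ℓⱼℤ)) × GL₂(ℤ_{ℓᵢ}) be the map that reduces the j-th coordinate modulo ℓⱼ for each j ≠ i and leaves the i-th coordinate unchanged, and let σ_i : (∏_{j ≠ i} GL₂(ℤ/ℓⱼℤ)) × GL₂(ℤ_{ℓᵢ}) → (∏_{j ≠ i} GL₂(ℤ/ℓⱼℤ)) × GL₂(ℤ/ℓᵢ^{tᵢ}ℤ) be the map reducing the i-th coordinate modulo ℓᵢ^{tᵢ}. Assume that for each i the image π_i(G) equals the full preimage under σ_i of σ_i(π_i(G)). Then G equals the full preimage of its image under the map ρ : ∏_{i=1}^q GL₂(ℤ_{ℓᵢ}) → ∏_{i=1}^q GL₂(ℤ/ℓᵢ^{tᵢ}ℤ) that reduces the i-th coordinate modulo ℓᵢ^{tᵢ}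 for every i; that is, every element g of ∏_{i=1}^q GL₂(ℤ_{ℓᵢ}) with ρ(g) ∈ ρ(G) lies in G. -/
open scoped MatrixGroups

open Filter Topology

section PrimePowers

variable {R : Type*} [Ring R]

theorem natCast_pow_succ_dvd_pow_sub_one {p : ℕ} {x : R} (hx : (p : R) ∣ x - 1) (n : ℕ) :
    (p : R) ^ (n + 1) ∣ x ^ p ^ n - 1 := by
  induction n with
  | zero => simpa using hx
  | succ n ih =>
    set y := x ^ p ^ n with hy
    have hpy : (p : R) ∣ y - 1 := hx.trans (sub_one_dvd_pow_sub_one x _)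
    have hsum : (p : R) ∣ ∑ i ∈ Finset.range p, y ^ i := by
      have h : ∑ i ∈ Finset.range p, y ^ i = ∑ i ∈ Finset.range p, (y ^ i - 1) + p := by
        simp
      rw [h]
      exact dvd_add (Finset.dvd_sum fun i _ => hpy.trans (sub_one_dvd_pow_sub_one y i)) dvd_rfl
    obtain ⟨b, hb⟩ := ih
    obtain ⟨c, hc⟩ := hsum
    refine ⟨b * c, ?_⟩
    rw [pow_succ p n, pow_mul, ← hy, ← mul_geom_sum, hb, hc, pow_succ _ (n + 1), mul_assoc,
      ← mul_assoc b, ← (Nat.cast_commute p b).eq]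
    simp only [mul_assoc]

theorem natCast_pow_dvd_pow_sub_one {p : ℕ} {x : R} (hx : (p : R) ∣ x - 1) {n a : ℕ}
    (ha : p ^ n ∣ a) : (p : R) ^ n ∣ x ^ a - 1 := by
  obtain ⟨c, rfl⟩ := ha
  rw [pow_mul]
  exact ((pow_dvd_pow _ n.le_succ).trans (natCast_pow_succ_dvd_pow_sub_one hx n)).trans
    (sub_one_dvd_pow_sub_one _ c)

end PrimePowers

section PadicMatrices

variable {p : ℕ} [Fact p.Prime] {m : Type*} [Fintype m] [DecidableEq m]

theorem Matrix.natCast_dvd_of_forall_dvd {S : Type*} [CommRing S] {k : ℕ} {M : Matrix m m S}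
    (h : ∀ i j, (k : S) ∣ M i j) : (k : Matrix m m S) ∣ M := by
  choose B hB using h
  refine ⟨Matrix.of B, ?_⟩
  rw [← nsmul_eq_mul]
  ext i j
  simp [hB i j]

theorem PadicInt.tendsto_matrix_pow_one {M : Matrix m m ℤ_[p]}
    (hM : (p : Matrix m m ℤ_[p]) ∣ M - 1) {a : ℕ → ℕ} (ha : ∀ n, p ^ n ∣ a n) :
    Tendsto (fun n => M ^ a n) atTop (𝓝 1) := by
  refine tendsto_pi_nhds.2 fun i => tendsto_pi_nhds.2 fun j => ?_
  rw [tendsto_iff_norm_sub_tendsto_zero]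
  have hp : 1 < (p : ℝ) := by exact_mod_cast (Fact.out : p.Prime).one_lt
  refine squeeze_zero (fun _ => norm_nonneg _) (fun n => ?_)
    (tendsto_pow_atTop_nhds_zero_of_lt_one (inv_nonneg.2 (by positivity)) (inv_lt_one_of_one_lt₀ hp))
  obtain ⟨B, hB⟩ := natCast_pow_dvd_pow_sub_one hM (ha n)
  have h : (M ^ a n) i j - (1 : Matrix m m ℤ_[p]) i j = (p : ℤ_[p]) ^ n * B i j := by
    rw [← Matrix.sub_apply, hB, ← Nat.cast_pow, ← nsmul_eq_mul]
    simp
  rw [h, norm_mul, norm_pow, PadicInt.norm_p]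
  exact mul_le_of_le_one_right (by positivity) (PadicInt.norm_le_one _)

theorem PadicInt.tendsto_generalLinearGroup_pow_one {x : GL m ℤ_[p]}
    (hx : (p : Matrix m m ℤ_[p]) ∣ (x : Matrix m m ℤ_[p]) - 1) {a : ℕ → ℕ}
    (ha : ∀ n, p ^ n ∣ a n) : Tendsto (fun n => x ^ a n) atTop (𝓝 1) := by
  have hinv : (p : Matrix m m ℤ_[p]) ∣ ((x⁻¹ : GL m ℤ_[p]) : Matrix m m ℤ_[p]) - 1 := by
    obtain ⟨B, hB⟩ := hx
    refine ⟨-(B * ((x⁻¹ : GL m ℤ_[p]) : Matrix m m ℤ_[p])), ?_⟩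
    rw [mul_neg, ← mul_assoc, ← hB, sub_mul, Units.mul_inv, one_mul, neg_sub]
  rw [Units.isInducing_embedProduct.tendsto_nhds_iff]
  refine Tendsto.prodMk_nhds ?_ ?_
  · simpa using PadicInt.tendsto_matrix_pow_one hx ha
  · refine (MulOpposite.continuous_op.tendsto _).comp ?_
    have h := PadicInt.tendsto_matrix_pow_one hinv ha
    simp only [← Units.val_pow_eq_pow_val, inv_pow] at h
    simpa using h

theorem PadicInt.natCast_dvd_sub_one_of_map_toZModPow {t : ℕ} (ht : 0 < t) {x : GL m ℤ_[p]}
    (hx : Matrix.GeneralLinearGroup.map (PadicInt.toZModPow t) x = 1) :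
    (p : Matrix m m ℤ_[p]) ∣ (x : Matrix m m ℤ_[p]) - 1 := by
  refine Matrix.natCast_dvd_of_forall_dvd fun i j => ?_
  have h : (x : Matrix m m ℤ_[p]) i j - (1 : Matrix m m ℤ_[p]) i j
      ∈ RingHom.ker (PadicInt.toZModPow (p := p) t) := by
    have := congrArg (fun y : GL m (ZMod (p ^ t)) => (y : Matrix m m (ZMod (p ^ t))) i j) hx
    rw [RingHom.mem_ker, map_sub, sub_eq_zero]
    simpa [Matrix.one_apply, apply_ite] using this
  rw [PadicInt.ker_toZModPow, Ideal.mem_span_singleton] at h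
  exact (dvd_pow_self _ ht.ne').trans h

theorem PadicInt.natCast_dvd_sub_one_of_map_toZMod {x : GL m ℤ_[p]}
    (hx : Matrix.GeneralLinearGroup.map PadicInt.toZMod x = 1) :
    (p : Matrix m m ℤ_[p]) ∣ (x : Matrix m m ℤ_[p]) - 1 := by
  refine Matrix.natCast_dvd_of_forall_dvd fun i j => ?_
  have h : (x : Matrix m m ℤ_[p]) i j - (1 : Matrix m m ℤ_[p]) i j
      ∈ RingHom.ker (PadicInt.toZMod (p := p)) := by
    have := congrArg (fun y : GL m (ZMod p) => (y : Matrix m m (ZMod p)) i j) hx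
    rw [RingHom.mem_ker, map_sub, sub_eq_zero]
    simpa [Matrix.one_apply, apply_ite] using this
  rwa [PadicInt.ker_toZMod, PadicInt.maximalIdeal_eq_span_p, Ideal.mem_span_singleton] at h

end PadicMatrices

/-- For distinct primes, there are exponents tending `ℓ i`-adically to `1` and `ℓ j`-adically to `0`
for every `j ≠ i`. -/
theorem exists_nat_seq_modEq_one_and_dvd {ι : Type*} [Fintype ι] [DecidableEq ι] {ℓ : ι → ℕ}
    (hℓ : ∀ i, (ℓ i).Prime) (hdist : Function.Injective ℓ) (i : ι) :
    ∃ b : ℕ → ℕ, (∀ n, 0 < b n) ∧ (∀ n, ℓ i ^ n ∣ b n - 1) ∧ ∀ j, j ≠ i → ∀ n, ℓ j ^ n ∣ b n := by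
  set P := ∏ j ∈ Finset.univ.erase i, ℓ j
  have hPpos : 0 < P := Finset.prod_pos fun j _ => (hℓ j).pos
  have hcop : Nat.Coprime P (ℓ i) := Nat.Coprime.prod_left fun j hj =>
    (Nat.coprime_primes (hℓ j) (hℓ i)).2 fun h => Finset.ne_of_mem_erase hj (hdist h)
  refine ⟨fun n => (P ^ n) ^ (ℓ i ^ n).totient, fun n => by positivity, fun n => ?_,
    fun j hj n => ?_⟩
  · exact (Nat.modEq_iff_dvd' (Nat.one_le_iff_ne_zero.2 (by positivity))).1
      (Nat.ModEq.pow_totient (hcop.pow n n)).symm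
  · have hdvd : ℓ j ∣ P := Finset.dvd_prod_of_mem ℓ (by simp [hj])
    have htot : (ℓ i ^ n).totient ≠ 0 := (Nat.totient_pos.2 (pow_pos (hℓ i).pos n)).ne'
    exact (pow_dvd_pow_of_dvd hdvd n).trans (dvd_pow_self _ htot)

/-- Proposition 3.5 of the paper.  Let `ℓ₁, …, ℓ_q` be distinct primes and
`t₁, …, t_q` positive integers, and let `G` be a closed subgroup of `∏ᵢ GL₂(ℤ_{ℓᵢ})`.
Suppose that for each `i`, the image `πᵢ(G)` of `G` in
`(∏_{j ≠ i} GL₂(ℤ/ℓⱼℤ)) × GL₂(ℤ_{ℓᵢ})` is the full preimage of its image obtained by further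
reducing the `i`-th coordinate modulo `ℓᵢ^{tᵢ}`.  Then `G` is the full preimage of its image
under reduction of each coordinate `i` modulo `ℓᵢ^{tᵢ}`. -/
theorem level_from_components (q : ℕ) (ℓ : Fin q → ℕ) [∀ i, Fact (ℓ i).Prime]
    (hdist : Function.Injective ℓ) (t : Fin q → ℕ) (ht : ∀ i, 0 < t i)
    (G : Subgroup (∀ i, GL (Fin 2) ℤ_[ℓ i]))
    (hG : IsClosed (G : Set (∀ i, GL (Fin 2) ℤ_[ℓ i])))
    (hlevel : ∀ i, ∀ g : ∀ j, GL (Fin 2) ℤ_[ℓ j],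
      (∃ h ∈ G,
          (∀ j, j ≠ i →
            Matrix.GeneralLinearGroup.map PadicInt.toZMod (h j) =
              Matrix.GeneralLinearGroup.map PadicInt.toZMod (g j)) ∧
          Matrix.GeneralLinearGroup.map (PadicInt.toZModPow (t i)) (h i) =
            Matrix.GeneralLinearGroup.map (PadicInt.toZModPow (t i)) (g i)) →
      ∃ h' ∈ G,
        (∀ j, j ≠ i →
          Matrix.GeneralLinearGroup.map PadicInt.toZMod (h' j) =
            Matrix.GeneralLinearGroup.map PadicInt.toZMod (g j)) ∧
        h' i = g i) :
    ∀ g : ∀ j, GL (Fin 2) ℤ_[ℓ j],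
      (∃ h ∈ G, ∀ i,
        Matrix.GeneralLinearGroup.map (PadicInt.toZModPow (t i)) (h i) =
          Matrix.GeneralLinearGroup.map (PadicInt.toZModPow (t i)) (g i)) →
      g ∈ G := by
  rintro g ⟨h, hh, hgh⟩
  suffices hmem : h⁻¹ * g ∈ G by simpa using G.mul_mem hh hmem
  refine Subgroup.pi_mem_of_mulSingle_mem _ fun i => ?_
  set u := (h⁻¹ * g) i with hu
  have hu1 : Matrix.GeneralLinearGroup.map (PadicInt.toZModPow (t i)) u = 1 := by
    simp [hu, hgh i]
  obtain ⟨k, hk, hkj, hki⟩ := hlevel i (Pi.mulSingle i u)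
    ⟨1, G.one_mem, fun j hj => by simp [hj], by simp [hu1]⟩
  rw [Pi.mulSingle_eq_same] at hki
  obtain ⟨b, hbpos, hbi, hbj⟩ :=
    exists_nat_seq_modEq_one_and_dvd (fun i => (Fact.out : (ℓ i).Prime)) hdist i
  refine hG.mem_of_tendsto (f := fun n => k ^ b n) (b := atTop) (tendsto_pi_nhds.2 fun j => ?_)
    (Eventually.of_forall fun n => G.pow_mem hk _)
  obtain rfl | hj := eq_or_ne j i
  · have hlim := (PadicInt.tendsto_generalLinearGroup_pow_one
      (PadicInt.natCast_dvd_sub_one_of_map_toZModPow (ht j) hu1) hbi).mul_const u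
    simpa [← pow_succ, Nat.sub_add_cancel (hbpos _), hki] using hlim
  · rw [Pi.mulSingle_eq_of_ne hj]
    refine PadicInt.tendsto_generalLinearGroup_pow_one
      (PadicInt.natCast_dvd_sub_one_of_map_toZMod ?_) (hbj j hj)
    simpa [hj] using hkj j hj
end

section
/- Let ℓ be a prime and let N be a positive integer with ℓ ∤ N. Set s₀ = 1 if ℓ is odd and s₀ = 2 if ℓ = 2. Let G be a closed subgroup of GL₂(ℤ/Nℤ) × GL₂(ℤ_ℓ). For each s ≥ 1, let G_{N,ℓˢ} denote the image of G in GL₂(ℤ/Nℤ) × GL₂(ℤ/ℓˢℤ) obtained by reducing the second coordinate modulo ℓˢ, let G_{ℓˢ} denote the image of G under the projection to GL₂(ℤ_ℓ) followed by reduction modulo ℓˢ, and let L_s ≤ GL₂(ℤ/Nℤ) denote the kernel of the projection G_{N,ℓˢ} → G_{ℓˢ}, viewed as a subgroup of GL₂(ℤ/Nℤ). Suppose r ≥ s₀ is an integer such that (i) G_{ℓ^{r+1}} is the full preimage of G_{ℓʳ} under the reduction map GL₂(ℤ/ℓ^{r+1}ℤ) → GL₂(ℤ/ℓʳℤ), and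 (ii) L_r = L_{r+1}. Then G is the full preimage of G_{N,ℓʳ} under the map GL₂(ℤ/Nℤ) × GL₂(ℤ_ℓ) → GL₂(ℤ/Nℤ) × GL₂(ℤ/ℓʳℤ) reducing the second coordinate modulo ℓʳ. -/
open scoped MatrixGroups

open Matrix in
/-- Congruence of matrices modulo `ℓ ^ n`. -/
theorem map_toZModPow_eq_iff {ℓ : ℕ} [Fact ℓ.Prime] (n : ℕ)
    (A B : GL (Fin 2) ℤ_[ℓ]) :
    GeneralLinearGroup.map (PadicInt.toZModPow n) A =
        GeneralLinearGroup.map (PadicInt.toZModPow n) B ↔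
      ∃ C : Matrix (Fin 2) (Fin 2) ℤ_[ℓ],
        (A : Matrix (Fin 2) (Fin 2) ℤ_[ℓ]) = B + (ℓ ^ n : ℤ_[ℓ]) • C := by
  have key (a b : ℤ_[ℓ]) : PadicInt.toZModPow n a = PadicInt.toZModPow n b ↔
      ∃ c, a = b + (ℓ ^ n : ℤ_[ℓ]) * c := by
    rw [← sub_eq_zero, ← map_sub, ← RingHom.mem_ker, PadicInt.ker_toZModPow,
      Ideal.mem_span_singleton]
    exact exists_congr fun c => sub_eq_iff_eq_add'
  rw [Units.ext_iff, ← Matrix.ext_iff]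
  simp only [GeneralLinearGroup.map_apply, key]
  constructor
  · intro h
    choose C hC using h
    exact ⟨Matrix.of C, Matrix.ext fun i j => by simpa using hC i j⟩
  · rintro ⟨C, hC⟩ i j
    exact ⟨C i j, by simp [hC]⟩

open Matrix in
theorem mem_ker_map_toZModPow_iff {ℓ : ℕ} [Fact ℓ.Prime] (n : ℕ) (A : GL (Fin 2) ℤ_[ℓ]) :
    A ∈ (GeneralLinearGroup.map (n := Fin 2) (PadicInt.toZModPow (p := ℓ) n)).ker ↔
      ∃ C : Matrix (Fin 2) (Fin 2) ℤ_[ℓ],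
        (A : Matrix (Fin 2) (Fin 2) ℤ_[ℓ]) = 1 + (ℓ ^ n : ℤ_[ℓ]) • C := by
  simpa [MonoidHom.mem_ker] using map_toZModPow_eq_iff n A 1

theorem exists_one_add_pow_eq {R : Type*} [CommRing R] (x : R) (n : ℕ) :
    ∃ E : R, (1 + x) ^ n = 1 + n * x + n.choose 2 * x ^ 2 + x ^ 3 * E := by
  induction n with
  | zero => exact ⟨0, by simp⟩
  | succ n ih =>
    obtain ⟨E, hE⟩ := ih
    refine ⟨E * (1 + x) + n.choose 2, ?_⟩
    rw [pow_succ, hE, Nat.choose_succ_succ' n 1]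
    push_cast [Nat.choose_one_right]
    ring

/-- Raising `1 + ℓ ^ s * x` to the `ℓ`-th power, modulo `ℓ ^ (s + 2)`. -/
theorem exists_one_add_prime_pow_mul_pow_eq {R : Type*} [CommRing R] {ℓ s : ℕ}
    (hℓ : ℓ.Prime) (hs : (if ℓ = 2 then 2 else 1) ≤ s) (x : R) :
    ∃ D : R, (1 + (ℓ : R) ^ s * x) ^ ℓ =
      1 + (ℓ : R) ^ (s + 1) * x + (ℓ : R) ^ (s + 2) * D := by
  obtain ⟨E, hE⟩ := exists_one_add_pow_eq ((ℓ : R) ^ s * x) ℓ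
  have hchoose : ℓ ^ (s + 2) ∣ ℓ.choose 2 * (ℓ ^ s) ^ 2 := by
    split_ifs at hs with h2
    · rw [← pow_mul]
      exact (pow_dvd_pow ℓ (by omega)).mul_left _
    · have h : ℓ ∣ ℓ.choose 2 :=
        hℓ.dvd_choose_self two_ne_zero (lt_of_le_of_ne hℓ.two_le (Ne.symm h2))
      rw [← pow_mul]
      exact (pow_dvd_pow ℓ (by omega : s + 2 ≤ 1 + s * 2)).trans
        (by rw [pow_add, pow_one]; exact mul_dvd_mul_right h _)
  have hcube : ℓ ^ (s + 2) ∣ (ℓ ^ s) ^ 3 := by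
    rw [← pow_mul]
    exact pow_dvd_pow ℓ (by split_ifs at hs <;> omega)
  obtain ⟨a, ha⟩ := hchoose
  obtain ⟨b, hb⟩ := hcube
  replace ha := congrArg (Nat.cast : ℕ → R) ha
  replace hb := congrArg (Nat.cast : ℕ → R) hb
  push_cast at ha hb
  refine ⟨a * x ^ 2 + b * x ^ 3 * E, ?_⟩
  rw [hE]
  linear_combination x ^ 2 * ha + x ^ 3 * E * hb

open Matrix in
theorem exists_one_add_smul_pow_eq {ℓ s : ℕ} [Fact ℓ.Prime]
    (hs : (if ℓ = 2 then 2 else 1) ≤ s) (B : Matrix (Fin 2) (Fin 2) ℤ_[ℓ]) :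
    ∃ D : Matrix (Fin 2) (Fin 2) ℤ_[ℓ], (1 + (ℓ ^ s : ℤ_[ℓ]) • B) ^ ℓ =
      1 + (ℓ ^ (s + 1) : ℤ_[ℓ]) • B + (ℓ ^ (s + 2) : ℤ_[ℓ]) • D := by
  obtain ⟨D, hD⟩ := exists_one_add_prime_pow_mul_pow_eq (Fact.out : ℓ.Prime) hs
    (Polynomial.X : Polynomial ℤ_[ℓ])
  refine ⟨Polynomial.aeval B D, ?_⟩
  have h := congrArg (Polynomial.aeval B) hD
  have hcast (n : ℕ) (M : Matrix (Fin 2) (Fin 2) ℤ_[ℓ]) :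
      (ℓ : Matrix (Fin 2) (Fin 2) ℤ_[ℓ]) ^ n * M = (ℓ ^ n : ℤ_[ℓ]) • M := by
    rw [Algebra.smul_def, map_pow, map_natCast]
  simpa [hcast] using h

open Matrix in
theorem exists_coe_eq_one_add_smul {ℓ s : ℕ} [Fact ℓ.Prime] (hs : s ≠ 0)
    (B : Matrix (Fin 2) (Fin 2) ℤ_[ℓ]) :
    ∃ C : GL (Fin 2) ℤ_[ℓ], (C : Matrix (Fin 2) (Fin 2) ℤ_[ℓ]) = 1 + (ℓ ^ s : ℤ_[ℓ]) • B := by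
  suffices h : IsUnit (1 + (ℓ ^ s : ℤ_[ℓ]) • B) from ⟨h.unit, h.unit_spec⟩
  rw [isUnit_iff_isUnit_det]
  refine isUnit_of_map_unit (PadicInt.toZMod (p := ℓ)) _ ?_
  have h : (PadicInt.toZMod (p := ℓ)).mapMatrix (1 + (ℓ ^ s : ℤ_[ℓ]) • B) = 1 := by
    ext i j
    simp [Matrix.one_apply, hs, apply_ite]
  rw [RingHom.map_det, h, det_one]
  exact isUnit_one

open Matrix in
/-- One step of the Lang–Trotter lifting: if `H` surjects onto the `s`-th graded piece of the
congruence filtration, then it surjects onto the next one. -/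
theorem exists_map_toZModPow_eq_succ {ℓ s : ℕ} [Fact ℓ.Prime]
    (hs : (if ℓ = 2 then 2 else 1) ≤ s) (H : Subgroup (GL (Fin 2) ℤ_[ℓ]))
    (hH : ∀ A ∈ (GeneralLinearGroup.map (n := Fin 2) (PadicInt.toZModPow (p := ℓ) s)).ker,
      ∃ h ∈ H, GeneralLinearGroup.map (PadicInt.toZModPow (s + 1)) h =
        GeneralLinearGroup.map (PadicInt.toZModPow (s + 1)) A) :
    ∀ A ∈ (GeneralLinearGroup.map (n := Fin 2) (PadicInt.toZModPow (p := ℓ) (s + 1))).ker,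
      ∃ h ∈ H, GeneralLinearGroup.map (PadicInt.toZModPow (s + 2)) h =
        GeneralLinearGroup.map (PadicInt.toZModPow (s + 2)) A := by
  intro A hA
  obtain ⟨B, hB⟩ := (mem_ker_map_toZModPow_iff _ _).1 hA
  obtain ⟨C, hC⟩ := exists_coe_eq_one_add_smul (s := s) (by split_ifs at hs <;> omega) B
  obtain ⟨h, hhH, hh⟩ := hH C ((mem_ker_map_toZModPow_iff _ _).2 ⟨B, hC⟩)
  rw [map_toZModPow_eq_iff] at hh
  obtain ⟨E, hE⟩ := hh
  obtain ⟨D, hD⟩ := exists_one_add_smul_pow_eq hs (B + (ℓ : ℤ_[ℓ]) • E)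
  refine ⟨h ^ ℓ, H.pow_mem hhH ℓ, (map_toZModPow_eq_iff _ _ _).2 ⟨E + D, ?_⟩⟩
  have hhE : (h : Matrix (Fin 2) (Fin 2) ℤ_[ℓ]) =
      1 + (ℓ ^ s : ℤ_[ℓ]) • (B + (ℓ : ℤ_[ℓ]) • E) := by
    rw [hE, hC, smul_add, smul_smul, ← pow_succ, add_assoc]
  rw [Units.val_pow_eq_pow_val, hhE, hD, hB]
  simp only [smul_add, smul_smul, ← pow_succ]
  abel

open Matrix in
theorem exists_map_toZModPow_eq_of_le {ℓ r : ℕ} [Fact ℓ.Prime]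
    (hr : (if ℓ = 2 then 2 else 1) ≤ r) (H : Subgroup (GL (Fin 2) ℤ_[ℓ]))
    (hH : ∀ A ∈ (GeneralLinearGroup.map (n := Fin 2) (PadicInt.toZModPow (p := ℓ) r)).ker,
      ∃ h ∈ H, GeneralLinearGroup.map (PadicInt.toZModPow (r + 1)) h =
        GeneralLinearGroup.map (PadicInt.toZModPow (r + 1)) A)
    {n : ℕ} (hn : r ≤ n) {A : GL (Fin 2) ℤ_[ℓ]}
    (hA : A ∈ (GeneralLinearGroup.map (n := Fin 2) (PadicInt.toZModPow (p := ℓ) r)).ker) :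
    ∃ h ∈ H, GeneralLinearGroup.map (PadicInt.toZModPow n) h =
      GeneralLinearGroup.map (PadicInt.toZModPow n) A := by
  have hstep : ∀ s, r ≤ s →
      ∀ A ∈ (GeneralLinearGroup.map (n := Fin 2) (PadicInt.toZModPow (p := ℓ) s)).ker,
        ∃ h ∈ H, GeneralLinearGroup.map (PadicInt.toZModPow (s + 1)) h =
          GeneralLinearGroup.map (PadicInt.toZModPow (s + 1)) A := by
    intro s hs
    induction s, hs using Nat.le_induction with
    | base => exact hH
    | succ s hs ih => exact exists_map_toZModPow_eq_succ (hr.trans hs) H ih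
  induction n, hn using Nat.le_induction with
  | base => exact ⟨1, H.one_mem, by rw [map_one, MonoidHom.mem_ker.1 hA]⟩
  | succ n hn ih =>
    obtain ⟨h, hhH, hh⟩ := ih
    obtain ⟨k, hkH, hk⟩ := hstep n hn (h⁻¹ * A) (by
      rw [MonoidHom.mem_ker, map_mul, map_inv, hh, inv_mul_cancel])
    exact ⟨h * k, H.mul_mem hhH hkH, by rw [map_mul, hk, map_mul, map_inv, mul_inv_cancel_left]⟩

open Matrix Filter Topology in
theorem tendsto_of_map_toZModPow_eq {ℓ : ℕ} [Fact ℓ.Prime] {u : ℕ → GL (Fin 2) ℤ_[ℓ]}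
    {A : GL (Fin 2) ℤ_[ℓ]}
    (hu : ∀ᶠ n in atTop, GeneralLinearGroup.map (PadicInt.toZModPow n) (u n) =
      GeneralLinearGroup.map (PadicInt.toZModPow n) A) :
    Tendsto u atTop (𝓝 A) := by
  have key {v : ℕ → GL (Fin 2) ℤ_[ℓ]} {B : GL (Fin 2) ℤ_[ℓ]}
      (hv : ∀ᶠ n in atTop, GeneralLinearGroup.map (PadicInt.toZModPow n) (v n) =
        GeneralLinearGroup.map (PadicInt.toZModPow n) B) :
      Tendsto (fun n => (v n : Matrix (Fin 2) (Fin 2) ℤ_[ℓ])) atTop (𝓝 B) := by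
    refine tendsto_pi_nhds.2 fun i => tendsto_pi_nhds.2 fun j => ?_
    rw [tendsto_iff_norm_sub_tendsto_zero]
    have hℓ : 1 < (ℓ : ℝ) := by exact_mod_cast (Fact.out : ℓ.Prime).one_lt
    refine squeeze_zero' (Eventually.of_forall fun _ => norm_nonneg _) ?_
      (tendsto_pow_atTop_nhds_zero_of_lt_one (inv_nonneg.2 (by positivity)) (inv_lt_one_of_one_lt₀ hℓ))
    filter_upwards [hv] with n hn
    obtain ⟨C, hC⟩ := (map_toZModPow_eq_iff _ _ _).1 hn
    simp only [hC, Matrix.add_apply, Matrix.smul_apply, add_sub_cancel_left, smul_eq_mul,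
      norm_mul, norm_pow, PadicInt.norm_p]
    exact mul_le_of_le_one_right (by positivity) (PadicInt.norm_le_one _)
  rw [Units.isInducing_embedProduct.tendsto_nhds_iff]
  refine (key hu).prodMk_nhds ((MulOpposite.continuous_op.tendsto _).comp (key ?_))
  filter_upwards [hu] with n hn
  rw [map_inv, map_inv, hn]

open Matrix in
/-- The Lang–Trotter level criterion for closed subgroups of `GL₂(ℤ_ℓ)`. -/
theorem ker_map_toZModPow_le_of_isClosed {ℓ r : ℕ} [Fact ℓ.Prime]
    (hr : (if ℓ = 2 then 2 else 1) ≤ r) (H : Subgroup (GL (Fin 2) ℤ_[ℓ]))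
    (hcl : IsClosed (H : Set (GL (Fin 2) ℤ_[ℓ])))
    (hH : ∀ A ∈ (GeneralLinearGroup.map (n := Fin 2) (PadicInt.toZModPow (p := ℓ) r)).ker,
      ∃ h ∈ H, GeneralLinearGroup.map (PadicInt.toZModPow (r + 1)) h =
        GeneralLinearGroup.map (PadicInt.toZModPow (r + 1)) A) :
    (GeneralLinearGroup.map (n := Fin 2) (PadicInt.toZModPow (p := ℓ) r)).ker ≤ H := by
  intro A hA
  choose u huH hu using fun n : ℕ =>
    exists_map_toZModPow_eq_of_le hr H hH (le_max_left r n) hA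
  refine hcl.mem_of_tendsto (tendsto_of_map_toZModPow_eq ?_)
    (Filter.Eventually.of_forall huH)
  filter_upwards [Filter.eventually_ge_atTop r] with n hn
  have h := hu n
  rwa [max_eq_right hn] at h

/-- key group-theoretic step in Proposition 6.1 of the paper.  Let `ℓ` be a
prime, `N` a positive integer with `ℓ ∤ N`, and `G` a closed subgroup of
`GL₂(ℤ/Nℤ) × GL₂(ℤ_ℓ)`.  For `s ≥ 1` write `G_{N,ℓˢ}` for the image of `G` in
`GL₂(ℤ/Nℤ) × GL₂(ℤ/ℓˢℤ)`, `G_{ℓˢ}` for the image of `G` under the second projection followed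
by reduction mod `ℓˢ`, and `L_s ≤ GL₂(ℤ/Nℤ)` for the kernel of `G_{N,ℓˢ} → G_{ℓˢ}`, i.e.
`L_s = {x | (x, 1) ∈ G_{N,ℓˢ}}`.  If `r ≥ s₀` (where `s₀ = 2` for `ℓ = 2` and `s₀ = 1`
otherwise) satisfies (i) `G_{ℓ^{r+1}}` is the full preimage of `G_{ℓʳ}` and (ii)
`L_r = L_{r+1}`, then `G` is the full preimage of `G_{N,ℓʳ}`. -/
theorem full_preimage_of_stable_kernels (ℓ N : ℕ) [Fact ℓ.Prime] (hN : 0 < N)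
    (hℓN : ¬ ℓ ∣ N)
    (G : Subgroup (GL (Fin 2) (ZMod N) × GL (Fin 2) ℤ_[ℓ]))
    (hG : IsClosed (G : Set (GL (Fin 2) (ZMod N) × GL (Fin 2) ℤ_[ℓ])))
    (r : ℕ) (hr : (if ℓ = 2 then 2 else 1) ≤ r)
    (h1 : G.map ((Matrix.GeneralLinearGroup.map (PadicInt.toZModPow (r + 1))).comp
            (MonoidHom.snd (GL (Fin 2) (ZMod N)) (GL (Fin 2) ℤ_[ℓ])))
        = (G.map ((Matrix.GeneralLinearGroup.map (PadicInt.toZModPow r)).comp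
            (MonoidHom.snd (GL (Fin 2) (ZMod N)) (GL (Fin 2) ℤ_[ℓ])))).comap
            (Matrix.GeneralLinearGroup.map
              (ZMod.castHom (pow_dvd_pow ℓ (Nat.le_succ r)) (ZMod (ℓ ^ r)))))
    (h2 : (G.map ((MonoidHom.id (GL (Fin 2) (ZMod N))).prodMap
              (Matrix.GeneralLinearGroup.map (PadicInt.toZModPow r)))).comap
            (MonoidHom.inl (GL (Fin 2) (ZMod N)) (GL (Fin 2) (ZMod (ℓ ^ r))))
        = (G.map ((MonoidHom.id (GL (Fin 2) (ZMod N))).prodMap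
              (Matrix.GeneralLinearGroup.map (PadicInt.toZModPow (r + 1))))).comap
            (MonoidHom.inl (GL (Fin 2) (ZMod N)) (GL (Fin 2) (ZMod (ℓ ^ (r + 1)))))) :
    G = (G.map ((MonoidHom.id (GL (Fin 2) (ZMod N))).prodMap
            (Matrix.GeneralLinearGroup.map (PadicInt.toZModPow r)))).comap
          ((MonoidHom.id (GL (Fin 2) (ZMod N))).prodMap
            (Matrix.GeneralLinearGroup.map (PadicInt.toZModPow r))) := by
  refine le_antisymm (Subgroup.le_comap_map _ _) ?_
  have hker : (Matrix.GeneralLinearGroup.map (n := Fin 2) (PadicInt.toZModPow (p := ℓ) r)).ker ≤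
      G.comap (MonoidHom.inr _ _) := by
    refine ker_map_toZModPow_le_of_isClosed hr _
      (hG.preimage (Continuous.prodMk_right (1 : GL (Fin 2) (ZMod N)))) fun A hA => ?_
    have hcomp : (Matrix.GeneralLinearGroup.map (ZMod.castHom (pow_dvd_pow ℓ (Nat.le_succ r))
          (ZMod (ℓ ^ r)))) (Matrix.GeneralLinearGroup.map (PadicInt.toZModPow (r + 1)) A) =
        Matrix.GeneralLinearGroup.map (PadicInt.toZModPow r) A := by
      rw [← PadicInt.zmod_cast_comp_toZModPow r (r + 1) r.le_succ,
        Matrix.GeneralLinearGroup.map_comp]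
      rfl
    have hmem : Matrix.GeneralLinearGroup.map (PadicInt.toZModPow (r + 1)) A ∈
        G.map ((Matrix.GeneralLinearGroup.map (PadicInt.toZModPow (r + 1))).comp
          (MonoidHom.snd (GL (Fin 2) (ZMod N)) (GL (Fin 2) ℤ_[ℓ]))) := by
      rw [h1, Subgroup.mem_comap, hcomp, MonoidHom.mem_ker.1 hA]
      exact one_mem _
    obtain ⟨⟨x, B⟩, hxB, hB⟩ := hmem
    change Matrix.GeneralLinearGroup.map _ B = _ at hB
    have hBr : Matrix.GeneralLinearGroup.map (PadicInt.toZModPow r) B = 1 := by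
      obtain ⟨C, hC⟩ := (map_toZModPow_eq_iff _ _ _).1 hB
      rw [← MonoidHom.mem_ker.1 hA, map_toZModPow_eq_iff]
      exact ⟨(ℓ : ℤ_[ℓ]) • C, by rw [hC, smul_smul, ← pow_succ]⟩
    have hx := h2.le (show x ∈ Subgroup.comap _ _ from ⟨(x, B), hxB, Prod.ext rfl hBr⟩)
    obtain ⟨⟨y, C⟩, hyC, hC⟩ := hx
    obtain ⟨rfl, hC⟩ := Prod.ext_iff.1 hC
    change Matrix.GeneralLinearGroup.map _ C = 1 at hC
    refine ⟨B * C⁻¹, ?_, by rw [map_mul, map_inv, hC, hB, inv_one, mul_one]⟩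
    have := G.mul_mem hxB (G.inv_mem hyC)
    simpa using this
  rintro ⟨x, A⟩ ⟨⟨y, B⟩, hyB, hBA⟩
  obtain ⟨rfl, hBA⟩ := Prod.ext_iff.1 hBA
  change Matrix.GeneralLinearGroup.map _ B = Matrix.GeneralLinearGroup.map _ A at hBA
  have hmem := hker (show B⁻¹ * A ∈ _ by
    rw [MonoidHom.mem_ker, map_mul, map_inv, hBA, inv_mul_cancel])
  simpa using G.mul_mem hyB hmem
end
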